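/- arXiv:2005.11559 — 5 statements merged into one kernel-verified Lean document; each statement's English description precedes it below -/
import Mathlib

section
/- Assume Hypothesis (U2) with constant C. Then for every set of squares A and every finite set S ⊆ ℤ one has Σ_{x : r_{A+S}(x) ≥ 5} r_{A+S}(x)⁴ ≤ 5C·|S|⁴, where the sum is over all integers x for which r_{A+S}(x) ≥ 5. -/
open Finset Pointwise

/-- Hypothesis (U2): an instance of the Uniformity Conjecture. -/
def U2 (C : ℕ) : Prop :=
  ∀ α β γ : ℤ, α ≠ 0 → β ≠ 0 → γ ≠ 0 → α ≠ β → α ≠ γ → β ≠ γ →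
    {p : ℚ × ℚ |
        p.2 ^ 2 = (p.1 ^ 2 + (α : ℚ)) * (p.1 ^ 2 + (β : ℚ)) * (p.1 ^ 2 + (γ : ℚ))}.Finite ∧
    {p : ℚ × ℚ |
        p.2 ^ 2 = (p.1 ^ 2 + (α : ℚ)) * (p.1 ^ 2 + (β : ℚ)) * (p.1 ^ 2 + (γ : ℚ))}.ncard ≤ C

/-- `r_{A+S}(x)`: the number of pairs `(a, s) ∈ A × S` with `a + s = x`. -/
def rAdd (A S : Finset ℤ) (x : ℤ) : ℕ :=
  ((A ×ˢ S).filter (fun p => p.1 + p.2 = x)).card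

/-- The elements `s ∈ S` for which `x - s ∈ A`. -/
def summandFiber (A S : Finset ℤ) (x : ℤ) : Finset ℤ :=
  S.filter (fun s => x - s ∈ A)

lemma mem_summandFiber {A S : Finset ℤ} {x s : ℤ} :
    s ∈ summandFiber A S x ↔ s ∈ S ∧ x - s ∈ A := by
  simp [summandFiber]

lemma rAdd_eq_card_summandFiber (A S : Finset ℤ) (x : ℤ) :
    rAdd A S x = (summandFiber A S x).card := by
  unfold rAdd
  refine Finset.card_bij (fun p _ => p.2) ?_ ?_ ?_
  · rintro ⟨a, s⟩ h
    simp only [mem_filter, mem_product] at h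
    rw [mem_summandFiber]
    refine ⟨h.1.2, ?_⟩
    rw [← h.2, add_sub_cancel_right]
    exact h.1.1
  · rintro ⟨a, s⟩ h ⟨b, t⟩ h' hst
    simp only [mem_filter, mem_product] at h h' hst
    ext <;> simp only <;> omega
  · intro s hs
    rw [mem_summandFiber] at hs
    exact ⟨(x - s, s), by simp [hs.1, hs.2], rfl⟩

/-- Under `U2 C`, at most `C / 2` integers `x` make all four of the differences `x - sᵢ` squares:
each such `x` yields two rational points `±(m, w)` on the associated curve. -/
lemma two_mul_card_le_of_isSquare_sub {C : ℕ} (hU : U2 C) {s₀ s₁ s₂ s₃ : ℤ}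
    (h01 : s₀ ≠ s₁) (h02 : s₀ ≠ s₂) (h03 : s₀ ≠ s₃) (h12 : s₁ ≠ s₂) (h13 : s₁ ≠ s₃)
    (h23 : s₂ ≠ s₃) (X : Finset ℤ)
    (hX : ∀ x ∈ X, (∃ m : ℤ, x - s₀ = m ^ 2) ∧ (∃ m : ℤ, x - s₁ = m ^ 2) ∧
      (∃ m : ℤ, x - s₂ = m ^ 2) ∧ ∃ m : ℤ, x - s₃ = m ^ 2) :
    2 * X.card ≤ C := by
  obtain ⟨hfin, hcard⟩ := hU (s₀ - s₁) (s₀ - s₂) (s₀ - s₃) (by omega) (by omega) (by omega)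
    (by omega) (by omega) (by omega)
  have key : ∀ x : ℤ, ∃ p : ℤ × ℤ, x ∈ X →
      x - s₀ = p.1 ^ 2 ∧ (x - s₁) * (x - s₂) * (x - s₃) = p.2 ^ 2 := by
    intro x
    by_cases hx : x ∈ X
    · obtain ⟨⟨m, hm⟩, ⟨a, ha⟩, ⟨b, hb⟩, ⟨c, hc⟩⟩ := hX x hx
      exact ⟨(m, a * b * c), fun _ => ⟨hm, by rw [ha, hb, hc]; ring⟩⟩
    · exact ⟨0, fun h => absurd h hx⟩
  choose p hp using key
  let f : ℤ × ℤ → ℚ × ℚ := fun q => ((q.2 * (p q.1).1 : ℤ), (q.2 * (p q.1).2 : ℤ))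
  have hle : (X ×ˢ ({1, -1} : Finset ℤ)).card ≤ hfin.toFinset.card := by
    refine Finset.card_le_card_of_injOn f ?_ ?_
    · rintro ⟨x, e⟩ h
      simp only [coe_product, Set.mem_prod, mem_coe, mem_insert, mem_singleton] at h
      obtain ⟨h1, h2⟩ := hp x h.1
      have he : e ^ 2 = 1 := by rcases h.2 with rfl | rfl <;> norm_num
      have h3 : (e * (p x).2) ^ 2 = ((e * (p x).1) ^ 2 + (s₀ - s₁)) *
          ((e * (p x).1) ^ 2 + (s₀ - s₂)) * ((e * (p x).1) ^ 2 + (s₀ - s₃)) := by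
        simp only [mul_pow, he, one_mul, ← h1, ← h2]
        ring
      simp only [Set.Finite.coe_toFinset, Set.mem_ofPred_eq, f]
      exact_mod_cast h3
    · rintro ⟨x, e⟩ h ⟨y, d⟩ h' hxy
      simp only [coe_product, Set.mem_prod, mem_coe, mem_insert, mem_singleton] at h h'
      simp only [f, Prod.mk.injEq, Int.cast_inj] at hxy
      obtain ⟨h1, h2⟩ := hp x h.1
      obtain ⟨h1', -⟩ := hp y h'.1
      have he : e ^ 2 = 1 := by rcases h.2 with rfl | rfl <;> norm_num
      have hd : d ^ 2 = 1 := by rcases h'.2 with rfl | rfl <;> norm_num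
      obtain rfl : x = y := by
        have h4 := congrArg (· ^ 2) hxy.1
        simp only [mul_pow, he, hd, one_mul, ← h1, ← h1'] at h4
        omega
      by_contra hne
      have hed : e - d ≠ 0 := fun h0 => hne (by rw [sub_eq_zero.mp h0])
      have hm : (p x).1 = 0 := by
        have : (e - d) * (p x).1 = 0 := by linarith [hxy.1]
        simpa [hed] using this
      have hw : (p x).2 = 0 := by
        have : (e - d) * (p x).2 = 0 := by linarith [hxy.2]
        simpa [hed] using this
      rw [hm] at h1
      obtain rfl : x = s₀ := by linarith
      rw [hw] at h2
      simp [sub_eq_zero, h01, h02, h03] at h2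
  rw [← Set.ncard_eq_toFinset_card _ hfin, card_product] at hle
  have h2 : ({1, -1} : Finset ℤ).card = 2 := rfl
  rw [h2] at hle
  omega

lemma Nat.twentyFour_mul_choose_four_le_pow (n : ℕ) : 24 * n.choose 4 ≤ n ^ 4 := by
  have h := Nat.descFactorial_eq_factorial_mul_choose n 4
  have h' := Nat.descFactorial_le_pow n 4
  have h4 : Nat.factorial 4 = 24 := rfl
  rw [h4] at h
  omega

lemma Nat.pow_four_le_mul_choose_four {n : ℕ} (hn : 5 ≤ n) : n ^ 4 ≤ 125 * n.choose 4 := by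
  obtain ⟨k, rfl⟩ := Nat.exists_eq_add_of_le' hn
  have h : (k + 5) * (k + 4) * (k + 3) * (k + 2) = 24 * (k + 5).choose 4 := by
    have := Nat.descFactorial_eq_factorial_mul_choose (k + 5) 4
    have h4 : Nat.factorial 4 = 24 := rfl
    rw [h4] at this
    rw [← this]
    simp [Nat.descFactorial]
    ring
  have h' : 24 * (k + 5) ^ 4 ≤ 125 * ((k + 5) * (k + 4) * (k + 3) * (k + 2)) := by
    ring_nf
    nlinarith [Nat.zero_le (k ^ 2), Nat.zero_le (k ^ 3), Nat.zero_le (k ^ 4)]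
  omega

/-- `Σ_{x : r_{A+S}(x) ≥ 5} r_{A+S}(x)⁴ ≤ 5C·|S|⁴` for any set of squares `A`
and any finite `S ⊆ ℤ`. -/
theorem squares_popular_sums (C : ℕ) (hC : 1 ≤ C) (hU : U2 C)
    (A : Finset ℤ) (hA : ∀ a ∈ A, ∃ m : ℤ, a = m ^ 2) (S : Finset ℤ) :
    ∑ x ∈ (A + S).filter (fun x => 5 ≤ rAdd A S x), rAdd A S x ^ 4 ≤
      5 * C * S.card ^ 4 := by
  set X := (A + S).filter (fun x => 5 ≤ rAdd A S x) with hX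
  have hpow : ∑ x ∈ X, rAdd A S x ^ 4 ≤ 125 * ∑ x ∈ X, (rAdd A S x).choose 4 := by
    rw [Finset.mul_sum]
    exact Finset.sum_le_sum fun x hx =>
      Nat.pow_four_le_mul_choose_four (Finset.mem_filter.mp hx).2
  have hcount : ∑ x ∈ X, (rAdd A S x).choose 4 =
      ∑ T ∈ S.powersetCard 4, (X.filter (fun x => T ⊆ summandFiber A S x)).card := by
    refine Eq.trans ?_ (Finset.sum_card_bipartiteAbove_eq_sum_card_bipartiteBelow
      (fun x T => T ⊆ summandFiber A S x))
    refine Finset.sum_congr rfl fun x _ => ?_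
    rw [rAdd_eq_card_summandFiber, ← Finset.card_powersetCard]
    congr 1
    ext T
    simp only [mem_powersetCard, bipartiteAbove, mem_filter]
    exact ⟨fun h => ⟨⟨h.1.trans (Finset.filter_subset _ _), h.2⟩, h.1⟩,
      fun h => ⟨h.2, h.1.2⟩⟩
  have hfiber : ∀ T ∈ S.powersetCard 4,
      2 * (X.filter (fun x => T ⊆ summandFiber A S x)).card ≤ C := by
    intro T hT
    obtain ⟨a, b, c, d, hab, hac, had, hbc, hbd, hcd, rfl⟩ :=
      Finset.card_eq_four.mp (Finset.mem_powersetCard.mp hT).2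
    refine two_mul_card_le_of_isSquare_sub hU hab hac had hbc hbd hcd _ fun x hx => ?_
    have hsub := (Finset.mem_filter.mp hx).2
    have hsq : ∀ s ∈ ({a, b, c, d} : Finset ℤ), ∃ m : ℤ, x - s = m ^ 2 := fun s hs =>
      hA _ (mem_summandFiber.mp (hsub hs)).2
    exact ⟨hsq a (by simp), hsq b (by simp), hsq c (by simp), hsq d (by simp)⟩
  have hsum : 2 * ∑ x ∈ X, (rAdd A S x).choose 4 ≤ S.card.choose 4 * C := by
    rw [hcount, Finset.mul_sum, ← Finset.card_powersetCard, ← smul_eq_mul]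
    exact Finset.sum_le_card_nsmul _ _ _ hfiber
  have hchoose := Nat.mul_le_mul_right C (Nat.twentyFour_mul_choose_four_le_pow S.card)
  nlinarith
end

section
/- Assume Hypotheses (U2) and (U6). Then there exists a constant K ≥ 1 (depending only on the constants in (U2) and (U6)) such that the following holds. Let A be a set of squares, let Q ⊆ ℤ be a finite set, and let L ⊆ ℤ × ℤ be a finite set of pairs (b, d) with b ≠ 0 for every (b, d) ∈ L. Then the number of triples (a, c, (b, d)) ∈ A × Q × L with a = b·c + d is at most K·(τ(L)^{1/6}·|Q|·|L|^{5/6} + |L|). -/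
open Finset

/-- Hypothesis (U6): an instance of the Uniformity Conjecture for genus-two curves
`y² = (x + c₁)⋯(x + c₆)` with pairwise distinct `cᵢ`. -/
def U6 (C' : ℕ) : Prop :=
  ∀ c : Fin 6 → ℤ, Function.Injective c →
    {p : ℚ × ℚ | p.2 ^ 2 = ∏ i, (p.1 + (c i : ℚ))}.Finite ∧
    {p : ℚ × ℚ | p.2 ^ 2 = ∏ i, (p.1 + (c i : ℚ))}.ncard ≤ C'

/-- `τ(L)`: the maximal number of points of `L` on a line `y = λ·x` through the origin
(with `x ≠ 0`). -/
def tau (L : Finset (ℤ × ℤ)) : ℕ :=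
  (L.image fun p => (p.2 : ℚ) / (p.1 : ℚ)).sup fun lam =>
    (L.filter fun p => p.1 ≠ 0 ∧ (p.2 : ℚ) = lam * (p.1 : ℚ)).card

/-- The slopes `d / b` of pairs `(b, d)` for which `b c + d` is a square for six given values
of `c` are abscissae of rational points on a genus-two curve. -/
theorem card_filter_forall_isSquare_le {C' : ℕ} (hU6 : U6 C') (L : Finset (ℤ × ℤ))
    (hL : ∀ p ∈ L, p.1 ≠ 0) (S : Finset ℤ) (hS : #S = 6) :
    #{p ∈ L | ∀ c ∈ S, IsSquare (p.1 * c + p.2)} ≤ tau L * C' := by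
  set M := {p ∈ L | ∀ c ∈ S, IsSquare (p.1 * c + p.2)} with hM
  refine (card_le_mul_card_image (f := fun p : ℤ × ℤ => (p.2 : ℚ) / (p.1 : ℚ)) M (tau L) ?_).trans
    (Nat.mul_le_mul_left _ ?_)
  · intro lam hlam
    have hlam' : lam ∈ L.image fun p => (p.2 : ℚ) / (p.1 : ℚ) :=
      image_subset_image (filter_subset _ _) hlam
    have htau : #{p ∈ L | p.1 ≠ 0 ∧ (p.2 : ℚ) = lam * (p.1 : ℚ)} ≤ tau L := by
      unfold tau
      exact le_sup (f := fun lam : ℚ => #{p ∈ L | p.1 ≠ 0 ∧ (p.2 : ℚ) = lam * (p.1 : ℚ)}) hlam'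
    refine le_trans (card_le_card ?_) htau
    intro p hp
    simp only [hM, mem_filter] at hp ⊢
    have hb : (p.1 : ℚ) ≠ 0 := by exact_mod_cast hL p hp.1.1
    exact ⟨hp.1.1, hL p hp.1.1, by rw [← hp.2, div_mul_cancel₀ _ hb]⟩
  · obtain ⟨hfin, hcard⟩ := hU6 (S.orderEmbOfFin hS) (S.orderEmbOfFin hS).injective
    rw [← Set.ncard_coe_finset]
    refine (Set.ncard_le_ncard ?_ (hfin.image Prod.fst)).trans ((Set.ncard_image_le hfin).trans hcard)
    intro lam hlam
    obtain ⟨p, hp, rfl⟩ := mem_image.1 (mem_coe.1 hlam)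
    simp only [hM, mem_filter] at hp
    have hb : (p.1 : ℚ) ≠ 0 := by exact_mod_cast hL p hp.1
    choose r hr using fun i => hp.2 _ (S.orderEmbOfFin_mem hS i)
    refine ⟨(_, (∏ i, (r i : ℚ)) / (p.1 : ℚ) ^ 3), ?_, rfl⟩
    have hfactor : ∀ i, (p.2 : ℚ) / p.1 + (S.orderEmbOfFin hS i : ℤ) = (r i : ℚ) ^ 2 / p.1 := by
      intro i
      have : (p.1 : ℚ) * (S.orderEmbOfFin hS i : ℤ) + p.2 = r i * r i := by exact_mod_cast hr i
      field_simp
      linarith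
    simp only [Set.mem_ofPred_eq, hfactor, prod_div_distrib, prod_pow, prod_const, card_univ,
      Fintype.card_fin]
    rw [div_pow, ← pow_mul]

theorem sum_choose_card_filter_isSquare_le {C' : ℕ} (hU6 : U6 C') (L : Finset (ℤ × ℤ))
    (hL : ∀ p ∈ L, p.1 ≠ 0) (Q : Finset ℤ) :
    ∑ p ∈ L, (#{c ∈ Q | IsSquare (p.1 * c + p.2)}).choose 6 ≤ (#Q).choose 6 * (tau L * C') := by
  calc ∑ p ∈ L, (#{c ∈ Q | IsSquare (p.1 * c + p.2)}).choose 6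
      = ∑ p ∈ L, #{S ∈ powersetCard 6 Q | ∀ c ∈ S, IsSquare (p.1 * c + p.2)} := by
        refine sum_congr rfl fun p _ => ?_
        rw [← card_powersetCard]
        congr 1
        ext S
        simp only [mem_powersetCard, mem_filter, subset_iff]
        grind
    _ = ∑ S ∈ powersetCard 6 Q, #{p ∈ L | ∀ c ∈ S, IsSquare (p.1 * c + p.2)} :=
        sum_card_bipartiteAbove_eq_sum_card_bipartiteBelow
          fun (p : ℤ × ℤ) (S : Finset ℤ) => ∀ c ∈ S, IsSquare (p.1 * c + p.2)
    _ ≤ (#Q).choose 6 * (tau L * C') := by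
        rw [← card_powersetCard, ← smul_eq_mul]
        exact sum_le_card_nsmul _ _ _ fun S hS =>
          card_filter_forall_isSquare_le hU6 L hL S (mem_powersetCard.1 hS).2

theorem sum_card_sub_five_pow_le {C' : ℕ} (hU6 : U6 C') (L : Finset (ℤ × ℤ))
    (hL : ∀ p ∈ L, p.1 ≠ 0) (Q : Finset ℤ) :
    ∑ p ∈ L, (#{c ∈ Q | IsSquare (p.1 * c + p.2)} - 5) ^ 6 ≤ #Q ^ 6 * (tau L * C') := by
  calc ∑ p ∈ L, (#{c ∈ Q | IsSquare (p.1 * c + p.2)} - 5) ^ 6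
      ≤ ∑ p ∈ L, Nat.factorial 6 * (#{c ∈ Q | IsSquare (p.1 * c + p.2)}).choose 6 := by
        refine sum_le_sum fun p _ => ?_
        rw [← Nat.descFactorial_eq_factorial_mul_choose]
        exact Nat.pow_sub_le_descFactorial _ 6
    _ ≤ Nat.factorial 6 * ((#Q).choose 6 * (tau L * C')) := by
        rw [← mul_sum]
        exact Nat.mul_le_mul_left _ (sum_choose_card_filter_isSquare_le hU6 L hL Q)
    _ ≤ #Q ^ 6 * (tau L * C') := by
        rw [← mul_assoc, ← Nat.descFactorial_eq_factorial_mul_choose]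
        exact Nat.mul_le_mul_right _ (Nat.descFactorial_le_pow _ _)

theorem sum_card_sub_five_le {C' : ℕ} (hC' : 1 ≤ C') (hU6 : U6 C') (L : Finset (ℤ × ℤ))
    (hL : ∀ p ∈ L, p.1 ≠ 0) (Q : Finset ℤ) :
    ((∑ p ∈ L, (#{c ∈ Q | IsSquare (p.1 * c + p.2)} - 5) : ℕ) : ℝ) ≤
      C' * ((tau L : ℝ) ^ ((1 : ℝ) / 6) * #Q * (#L : ℝ) ^ ((5 : ℝ) / 6)) := by
  have hroot (x : ℝ) (hx : 0 ≤ x) (n : ℕ) : (x ^ ((n : ℝ) / 6)) ^ 6 = x ^ n := by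
    rw [← Real.rpow_natCast, ← Real.rpow_mul hx, ← Real.rpow_natCast]
    congr 1
    push_cast
    ring
  have hτ := hroot (tau L) (Nat.cast_nonneg _) 1
  have hcard := hroot #L (Nat.cast_nonneg _) 5
  push_cast at hτ hcard
  have hpow : (∑ p ∈ L, (#{c ∈ Q | IsSquare (p.1 * c + p.2)} - 5)) ^ 6 ≤
      #L ^ 5 * (#Q ^ 6 * (tau L * C')) :=
    (pow_sum_le_card_mul_sum_pow (fun _ _ => Nat.zero_le _) 5).trans
      (Nat.mul_le_mul_left _ (sum_card_sub_five_pow_le hU6 L hL Q))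
  have hC6 : (C' : ℝ) ≤ (C' : ℝ) ^ 6 := le_self_pow₀ (by exact_mod_cast hC') (by norm_num)
  refine le_of_pow_le_pow_left₀ (n := 6) (by norm_num) (by positivity) ?_
  calc ((∑ p ∈ L, (#{c ∈ Q | IsSquare (p.1 * c + p.2)} - 5) : ℕ) : ℝ) ^ 6
      ≤ (#L : ℝ) ^ 5 * ((#Q : ℝ) ^ 6 * (tau L * C')) := by exact_mod_cast hpow
    _ ≤ (#L : ℝ) ^ 5 * ((#Q : ℝ) ^ 6 * (tau L * (C' : ℝ) ^ 6)) := by gcongr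
    _ = _ := by
        rw [mul_pow, mul_pow, mul_pow, hτ, hcard]
        ring

theorem card_incidences_le {A Q : Finset ℤ} {L : Finset (ℤ × ℤ)}
    (hA : ∀ a ∈ A, ∃ m : ℤ, a = m ^ 2) :
    #{t ∈ A ×ˢ Q ×ˢ L | t.1 = t.2.2.1 * t.2.1 + t.2.2.2} ≤
      ∑ p ∈ L, #{c ∈ Q | IsSquare (p.1 * c + p.2)} := by
  rw [← card_sigma]
  refine card_le_card_of_injOn (fun t => ⟨t.2.2, t.2.1⟩) ?_ ?_
  · rintro ⟨a, c, p⟩ ht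
    simp only [coe_filter, mem_product, Set.mem_ofPred_eq] at ht
    obtain ⟨⟨ha, hc, hp⟩, rfl⟩ := ht
    obtain ⟨m, hm⟩ := hA _ ha
    simpa only [coe_sigma, Set.mem_sigma_iff, mem_coe, mem_filter] using
      ⟨hp, hc, m, hm.trans (sq m)⟩
  · rintro ⟨a, c, p⟩ ht ⟨a', c', p'⟩ ht' h
    simp only [coe_filter, Set.mem_ofPred_eq] at ht ht'
    simp only [Sigma.mk.injEq, heq_eq_eq] at h
    obtain ⟨rfl, rfl⟩ := h
    rw [ht.2, ht'.2]

/-- incidence bound for squares: the number of solutions to `a = b·c + d`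
with `a ∈ A`, `c ∈ Q`, `(b, d) ∈ L` is `O(τ(L)^{1/6}·|Q|·|L|^{5/6} + |L|)`. -/
theorem squares_incidences (C C' : ℕ) (hC : 1 ≤ C) (hC' : 1 ≤ C')
    (hU2 : U2 C) (hU6 : U6 C') :
    ∃ K : ℝ, 1 ≤ K ∧
      ∀ (A : Finset ℤ), (∀ a ∈ A, ∃ m : ℤ, a = m ^ 2) →
      ∀ (Q : Finset ℤ) (L : Finset (ℤ × ℤ)), (∀ p ∈ L, p.1 ≠ 0) →
        ((((A ×ˢ Q ×ˢ L).filter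
            (fun t => t.1 = t.2.2.1 * t.2.1 + t.2.2.2)).card : ℝ)) ≤
          K * ((tau L : ℝ) ^ ((1 : ℝ) / 6) * (Q.card : ℝ) * (L.card : ℝ) ^ ((5 : ℝ) / 6) +
                (L.card : ℝ)) := by
  refine ⟨C' + 5, by linarith [(Nat.cast_nonneg C' : (0 : ℝ) ≤ C')], fun A hA Q L hL => ?_⟩
  have hsum : ∑ p ∈ L, #{c ∈ Q | IsSquare (p.1 * c + p.2)} ≤
      ∑ p ∈ L, (#{c ∈ Q | IsSquare (p.1 * c + p.2)} - 5) + 5 * #L := by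
    rw [mul_comm, ← smul_eq_mul, ← sum_const, ← sum_add_distrib]
    exact sum_le_sum fun p _ => le_tsub_add
  have hI : (#{t ∈ A ×ˢ Q ×ˢ L | t.1 = t.2.2.1 * t.2.1 + t.2.2.2} : ℝ) ≤
      ((∑ p ∈ L, (#{c ∈ Q | IsSquare (p.1 * c + p.2)} - 5) : ℕ) : ℝ) + 5 * #L := by
    exact_mod_cast (card_incidences_le hA).trans hsum
  have hmain := sum_card_sub_five_le hC' hU6 L hL Q
  have hX : 0 ≤ (tau L : ℝ) ^ ((1 : ℝ) / 6) * #Q * (#L : ℝ) ^ ((5 : ℝ) / 6) := by positivity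
  have hY : 0 ≤ (C' : ℝ) * #L := by positivity
  linarith
end

section
/- Assume Hypothesis (U2). Then for every real α with 0 < α < 1/11 there exist constants c > 0 and C₀ ≥ 1 (depending only on α and on the constant in (U2)) such that every set of squares A with |A| ≥ 2 satisfies E(A) ≤ C₀·|A|^{8/3}·exp(−c·(log |A|)^α), where E(A) = Σ_x r_{A−A}(x)² is the additive energy of A. -/
open Finset Pointwise

/-- The additive energy `E(A) = Σ_x r_{A−A}(x)²`. -/
def addEnergy (A : Finset ℤ) : ℕ :=
  ∑ x ∈ A - A, ((A ×ˢ A).filter (fun p => p.1 - p.2 = x)).card ^ 2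

/-- A polynomial lower bound for `w.choose 4`, up to a constant. -/
lemma pow_four_le_choose (w : ℕ) : w ^ 4 ≤ 192 * w.choose 4 + 1296 := by
  rcases lt_or_ge w 6 with h | h
  · interval_cases w <;> decide
  · obtain ⟨k, rfl⟩ := Nat.exists_eq_add_of_le h
    have h1 := Nat.descFactorial_eq_factorial_mul_choose (6 + k) 4
    have h2 : Nat.descFactorial (6 + k) 4 = (k + 3) * ((k + 4) * ((k + 5) * (k + 6))) := by
      simp only [Nat.descFactorial]
      have e0 : 6 + k - 0 = k + 6 := by omega
      have e1 : 6 + k - 1 = k + 5 := by omega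
      have e2 : 6 + k - 2 = k + 4 := by omega
      have e3 : 6 + k - 3 = k + 3 := by omega
      rw [e0, e1, e2, e3]; ring
    have h3 : Nat.factorial 4 = 24 := rfl
    rw [h2, h3] at h1
    have : (6 + k) ^ 4 ≤ 8 * ((k + 3) * ((k + 4) * ((k + 5) * (k + 6)))) := by
      ring_nf; nlinarith [sq_nonneg k]
    omega

lemma choose_four_le (w : ℕ) : 24 * w.choose 4 ≤ w ^ 4 := by
  have h1 := Nat.descFactorial_eq_factorial_mul_choose w 4
  have h3 : Nat.factorial 4 = 24 := rfl
  rw [h3] at h1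
  rw [← h1]
  exact Nat.descFactorial_le_pow w 4

/-- If every four-element subset of `H` has at most `c` common neighbours in `I`,
then the degrees of `I` are bounded in fourth moment. -/
lemma sum_pow_four_le {ι : Type*} (I : Finset ι) (H : Finset ℤ) (rel : ι → ℤ → Prop)
    [∀ i, DecidablePred (rel i)] (c : ℕ)
    (hc : ∀ Z ⊆ H, #Z = 4 → #{i ∈ I | ∀ z ∈ Z, rel i z} ≤ c) :
    ∑ i ∈ I, #{h ∈ H | rel i h} ^ 4 ≤ 8 * c * #H ^ 4 + 1296 * #I := by
  classical
  have key : ∑ i ∈ I, (#{h ∈ H | rel i h}).choose 4 ≤ c * (#H).choose 4 := by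
    calc ∑ i ∈ I, (#{h ∈ H | rel i h}).choose 4
        = ∑ i ∈ I, #{Z ∈ powersetCard 4 H | ∀ z ∈ Z, rel i z} := by
          refine sum_congr rfl fun i _ => ?_
          rw [← card_powersetCard]
          congr 1
          ext Z
          simp only [mem_powersetCard, mem_filter, subset_iff]
          constructor
          · rintro ⟨h1, h2⟩
            exact ⟨⟨fun z hz => (h1 hz).1, h2⟩, fun z hz => (h1 hz).2⟩
          · rintro ⟨⟨h1, h2⟩, h3⟩
            exact ⟨fun z hz => ⟨h1 hz, h3 z hz⟩, h2⟩
      _ = ∑ Z ∈ powersetCard 4 H, #{i ∈ I | ∀ z ∈ Z, rel i z} :=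
          sum_card_bipartiteAbove_eq_sum_card_bipartiteBelow _
      _ ≤ ∑ Z ∈ powersetCard 4 H, c := by
          refine sum_le_sum fun Z hZ => ?_
          rw [mem_powersetCard] at hZ
          exact hc Z hZ.1 hZ.2
      _ = c * (#H).choose 4 := by simp [mul_comm]
  calc ∑ i ∈ I, #{h ∈ H | rel i h} ^ 4
      ≤ ∑ i ∈ I, (192 * (#{h ∈ H | rel i h}).choose 4 + 1296) :=
        sum_le_sum fun i _ => pow_four_le_choose _
    _ = 192 * ∑ i ∈ I, (#{h ∈ H | rel i h}).choose 4 + 1296 * #I := by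
        rw [sum_add_distrib, ← mul_sum]; simp [mul_comm]
    _ ≤ 192 * (c * (#H).choose 4) + 1296 * #I := by gcongr
    _ = 8 * c * (24 * (#H).choose 4) + 1296 * #I := by ring
    _ ≤ _ := by gcongr; exact choose_four_le _

/-- Under `U2`, at most `C` rationals `ρ` make all four `ρ² + (z - z₀)` squares. -/
lemma card_ratio_le {C : ℕ} (hU : U2 C) (Z : Finset ℤ) (hZ : #Z = 4) (z₀ : ℤ) (hz₀ : z₀ ∈ Z)
    (W : Finset ℚ) (hW : ∀ ρ ∈ W, ∀ z ∈ Z, ∃ s : ℚ, ρ ^ 2 + ((z - z₀ : ℤ) : ℚ) = s ^ 2) :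
    #W ≤ C := by
  classical
  have h3 : #(Z.erase z₀) = 3 := by rw [card_erase_of_mem hz₀, hZ]
  obtain ⟨a, b, c, hab, hac, hbc, he⟩ := card_eq_three.1 h3
  have ma : a ∈ Z.erase z₀ := by rw [he]; simp
  have mb : b ∈ Z.erase z₀ := by rw [he]; simp
  have mc : c ∈ Z.erase z₀ := by rw [he]; simp
  rw [mem_erase] at ma mb mc
  obtain ⟨hfin, hcard⟩ := hU (a - z₀) (b - z₀) (c - z₀) (sub_ne_zero.2 ma.1) (sub_ne_zero.2 mb.1)
    (sub_ne_zero.2 mc.1) (by simpa using hab) (by simpa using hac) (by simpa using hbc)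
  have hex : ∀ ρ : ℚ, ∃ y : ℚ, ρ ∈ W → y ^ 2 = (ρ ^ 2 + ((a - z₀ : ℤ) : ℚ)) *
      (ρ ^ 2 + ((b - z₀ : ℤ) : ℚ)) * (ρ ^ 2 + ((c - z₀ : ℤ) : ℚ)) := by
    intro ρ
    by_cases hρ : ρ ∈ W
    · obtain ⟨s, hs⟩ := hW ρ hρ a ma.2
      obtain ⟨t, ht⟩ := hW ρ hρ b mb.2
      obtain ⟨u, hu⟩ := hW ρ hρ c mc.2
      exact ⟨s * t * u, fun _ => by rw [hs, ht, hu]; ring⟩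
    · exact ⟨0, fun h => absurd h hρ⟩
  choose y hy using hex
  refine le_trans ?_ hcard
  rw [← Set.ncard_coe_finset W]
  refine Set.ncard_le_ncard_of_injOn (fun ρ => (ρ, y ρ)) (fun ρ hρ => ?_) ?_ hfin
  · exact hy ρ hρ
  · intro ρ _ σ _ h
    exact (Prod.mk.inj h).1

/-- The number of representations `r_{A-A}(x)`. -/
def rep (A : Finset ℤ) (x : ℤ) : ℕ := #{p ∈ A ×ˢ A | p.1 - p.2 = x}

lemma rep_eq_card (A : Finset ℤ) (x : ℤ) : rep A x = #{h ∈ A | x + h ∈ A} := by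
  unfold rep
  refine card_bij' (fun p _ => p.2) (fun h _ => (x + h, h)) ?_ ?_ ?_ ?_
  · rintro ⟨a, b⟩ h
    simp only [mem_filter, mem_product] at h ⊢
    refine ⟨h.1.2, ?_⟩
    rw [← h.2]; simpa using h.1.1
  · intro h hh
    simp only [mem_filter, mem_product] at hh ⊢
    exact ⟨⟨hh.2, hh.1⟩, by ring⟩
  · rintro ⟨a, b⟩ h
    simp only [mem_filter, mem_product] at h ⊢
    rw [← h.2]; simp
  · intro h hh; rfl

lemma rep_neg (A : Finset ℤ) (x : ℤ) : rep A (-x) = rep A x := by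
  unfold rep
  refine card_bij' (fun p _ => (p.2, p.1)) (fun p _ => (p.2, p.1)) ?_ ?_ ?_ ?_
  · rintro ⟨a, b⟩ h
    simp only [mem_filter, mem_product] at h ⊢
    exact ⟨h.1.symm, by linarith [h.2]⟩
  · rintro ⟨a, b⟩ h
    simp only [mem_filter, mem_product] at h ⊢
    exact ⟨h.1.symm, by linarith [h.2]⟩
  · rintro ⟨a, b⟩ h; rfl
  · rintro ⟨a, b⟩ h; rfl

lemma rep_le_card (A : Finset ℤ) (x : ℤ) : rep A x ≤ #A := by
  rw [rep_eq_card]; exact card_filter_le _ _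

lemma sum_pairs_rep (A : Finset ℤ) (f : ℤ → ℝ) :
    ∑ a ∈ A, ∑ b ∈ A, f (a - b) = ∑ x ∈ A - A, (rep A x : ℝ) * f x := by
  rw [← sum_product' A A (fun a b => f (a - b))]
  rw [← sum_fiberwise_of_maps_to (s := A ×ˢ A) (t := A - A) (g := fun p => p.1 - p.2)
    (fun p hp => by
      rw [mem_product] at hp
      exact sub_mem_sub hp.1 hp.2)]
  refine sum_congr rfl fun x _ => ?_
  rw [sum_congr rfl (g := fun _ => f x) (fun p hp => by rw [(mem_filter.1 hp).2])]
  simp [rep]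

lemma addEnergy_eq (A : Finset ℤ) :
    (_root_.addEnergy A : ℝ) = ∑ a ∈ A, ∑ b ∈ A, (rep A (a - b) : ℝ) := by
  rw [sum_pairs_rep A (fun x => (rep A x : ℝ))]
  unfold _root_.addEnergy
  push_cast
  refine sum_congr rfl fun x _ => ?_
  rw [sq]; rfl

lemma addEnergy_le (A : Finset ℤ) : (_root_.addEnergy A : ℝ) ≤ (#A : ℝ) ^ 3 := by
  rw [addEnergy_eq]
  calc ∑ a ∈ A, ∑ b ∈ A, (rep A (a - b) : ℝ) ≤ ∑ a ∈ A, ∑ b ∈ A, (#A : ℝ) := by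
        gcongr; exact_mod_cast rep_le_card _ _
    _ = _ := by simp; ring

/-- The fourth-moment bound for sets of squares. -/
lemma sum_rep_pow_four_le {C : ℕ} (hU : U2 C) (A : Finset ℤ) (hA : ∀ a ∈ A, ∃ m : ℤ, a = m ^ 2) :
    ∑ x ∈ A - A, rep A x ^ 4 ≤ (8 * C + 1296) * #A ^ 4 := by
  have hex : ∀ a : ℤ, ∃ m : ℤ, a ∈ A → a = m ^ 2 := by
    intro a
    by_cases ha : a ∈ A
    · obtain ⟨m, hm⟩ := hA a ha
      exact ⟨m, fun _ => hm⟩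
    · exact ⟨0, fun h => absurd h ha⟩
  choose m hm using hex
  have h := sum_pow_four_le (A - A) A (fun x h => x + h ∈ A) C ?_
  · have h2 : #(A - A) ≤ #A ^ 4 := by
      calc #(A - A) ≤ #A * #A := card_sub_le
        _ = #A ^ 2 := by ring
        _ ≤ #A ^ 4 := by
          rcases Nat.eq_zero_or_pos (#A) with h0 | h0
          · simp [h0]
          · exact Nat.pow_le_pow_right h0 (by norm_num)
    calc ∑ x ∈ A - A, rep A x ^ 4 = ∑ x ∈ A - A, #{h ∈ A | x + h ∈ A} ^ 4 := by
          simp only [rep_eq_card]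
      _ ≤ _ := h
      _ ≤ 8 * C * #A ^ 4 + 1296 * #A ^ 4 := by gcongr
      _ = _ := by ring
  · intro Z hZA hZ
    obtain ⟨z₀, hz₀⟩ : Z.Nonempty := card_pos.1 (by omega)
    set I := {x ∈ A - A | ∀ z ∈ Z, x + z ∈ A} with hI
    have hinj : Set.InjOn (fun x : ℤ => ((m (x + z₀) : ℤ) : ℚ)) (I : Set ℤ) := by
      intro x hx y hy hxy
      have hx' := hm _ ((mem_filter.1 hx).2 z₀ hz₀)
      have hy' := hm _ ((mem_filter.1 hy).2 z₀ hz₀)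
      have : m (x + z₀) = m (y + z₀) := Int.cast_injective (α := ℚ) hxy
      rw [← this, ← hx'] at hy'
      linarith
    rw [← card_image_of_injOn hinj]
    refine card_ratio_le hU Z hZ z₀ hz₀ _ ?_
    intro ρ hρ z hz
    obtain ⟨x, hx, rfl⟩ := mem_image.1 hρ
    have h1 := hm _ ((mem_filter.1 hx).2 z₀ hz₀)
    have h2 := hm _ ((mem_filter.1 hx).2 z hz)
    refine ⟨m (x + z), ?_⟩
    have : m (x + z₀) ^ 2 + (z - z₀) = m (x + z) ^ 2 := by rw [← h1, ← h2]; ring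
    exact_mod_cast this

/-- For a Gram matrix `R`, a lower bound for the trace of `R³`. -/
lemma trace_cube_ge {ι κ : Type*} (A : Finset ι) (J : Finset κ) (B : ι → κ → ℝ)
    (R : ι → ι → ℝ) (hR : ∀ a b, R a b = ∑ j ∈ J, B a j * B b j)
    (hpos : 0 < ∑ a ∈ A, ∑ b ∈ A, R a b) :
    (∑ b ∈ A, (∑ a ∈ A, R a b) ^ 2) * (∑ a ∈ A, ∑ b ∈ A, R a b) ≤
      (#A : ℝ) ^ 2 * ∑ a ∈ A, ∑ b ∈ A, ∑ c ∈ A, R a b * R b c * R c a := by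
  have hsymm : ∀ a b, R a b = R b a := fun a b => by
    rw [hR, hR]; exact sum_congr rfl fun _ _ => mul_comm _ _
  set S : κ → ℝ := fun j => ∑ a ∈ A, B a j with hS
  set v : ι → ℝ := fun b => ∑ a ∈ A, R a b with hv
  set V : κ → ℝ := fun j => ∑ b ∈ A, v b * B b j with hV
  set m1 := ∑ a ∈ A, ∑ b ∈ A, R a b with hm1
  set τ := ∑ a ∈ A, ∑ b ∈ A, ∑ c ∈ A, R a b * R b c * R c a with hτ
  have hv' : ∀ b, v b = ∑ j ∈ J, S j * B b j := by
    intro b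
    simp only [hv, hS, hR]
    rw [sum_comm]
    exact sum_congr rfl fun j _ => by rw [sum_mul]
  have e1 : m1 = ∑ j ∈ J, S j ^ 2 := by
    rw [hm1, sum_comm]
    change ∑ b ∈ A, v b = _
    simp only [hv']
    rw [sum_comm]
    refine sum_congr rfl fun j _ => ?_
    rw [← mul_sum, sq]
  have e1' : m1 = ∑ b ∈ A, v b := by rw [hm1, sum_comm]
  have e2 : ∑ b ∈ A, v b ^ 2 = ∑ j ∈ J, S j * V j := by
    calc ∑ b ∈ A, v b ^ 2 = ∑ b ∈ A, v b * ∑ j ∈ J, S j * B b j :=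
          sum_congr rfl fun b _ => by rw [sq, ← hv' b]
      _ = ∑ b ∈ A, ∑ j ∈ J, S j * (v b * B b j) :=
          sum_congr rfl fun b _ => by
            rw [mul_sum]; exact sum_congr rfl fun j _ => by ring
      _ = ∑ j ∈ J, S j * V j := by
          rw [sum_comm]; exact sum_congr rfl fun j _ => by rw [hV, mul_sum]
  have c1 : (∑ b ∈ A, v b ^ 2) ^ 2 ≤ m1 * ∑ j ∈ J, V j ^ 2 := by
    rw [e2, e1]; exact sum_mul_sq_le_sq_mul_sq _ _ _
  have c2 : m1 ^ 2 ≤ #A * ∑ b ∈ A, v b ^ 2 := by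
    rw [e1']; exact sq_sum_le_card_mul_sum_sq
  have c3 : ∑ j ∈ J, V j ^ 2 ≤ #A * τ := by
    have hF : ∀ j, V j = ∑ a ∈ A, ∑ b ∈ A, R a b * B b j := by
      intro j
      simp only [hV, hv, sum_mul]
      rw [sum_comm]
    calc ∑ j ∈ J, V j ^ 2 ≤ ∑ j ∈ J, #A * ∑ a ∈ A, (∑ b ∈ A, R a b * B b j) ^ 2 := by
          refine sum_le_sum fun j _ => ?_
          rw [hF]; exact sq_sum_le_card_mul_sum_sq
      _ = #A * ∑ a ∈ A, ∑ j ∈ J, (∑ b ∈ A, R a b * B b j) ^ 2 := by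
          rw [← mul_sum, sum_comm]
      _ = #A * τ := by
          congr 1
          refine sum_congr rfl fun a _ => ?_
          calc ∑ j ∈ J, (∑ b ∈ A, R a b * B b j) ^ 2
              = ∑ j ∈ J, ∑ b ∈ A, ∑ c ∈ A, (R a b * B b j) * (R a c * B c j) :=
                sum_congr rfl fun j _ => by rw [sq, sum_mul_sum]
            _ = ∑ b ∈ A, ∑ c ∈ A, ∑ j ∈ J, (R a b * B b j) * (R a c * B c j) := by
                rw [sum_comm]; exact sum_congr rfl fun b _ => sum_comm
            _ = _ := by
                refine sum_congr rfl fun b _ => sum_congr rfl fun c _ => ?_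
                rw [hsymm c a, hR b c]
                rw [mul_sum, sum_mul]
                exact sum_congr rfl fun j _ => by ring
  have hn : (0 : ℝ) ≤ #A := by positivity
  have hm2 : 0 ≤ ∑ b ∈ A, v b ^ 2 := sum_nonneg fun _ _ => sq_nonneg _
  set m2 := ∑ b ∈ A, v b ^ 2 with hm2'
  have f1 : m2 ^ 2 ≤ m1 * (#A * τ) := c1.trans (by gcongr)
  have f2 : m1 * (m2 * m1) ≤ m1 * ((#A : ℝ) ^ 2 * τ) := by
    calc m1 * (m2 * m1) = m2 * m1 ^ 2 := by ring
      _ ≤ m2 * (#A * m2) := by gcongr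
      _ = #A * m2 ^ 2 := by ring
      _ ≤ #A * (m1 * (#A * τ)) := by gcongr
      _ = _ := by ring
  exact le_of_mul_le_mul_left f2 hpos

lemma sq_card_le_card_mul_card_pairs {α β : Type*} [DecidableEq β] (Q : Finset α) (N : Finset β)
    (f : α → β) (hf : ∀ q ∈ Q, f q ∈ N) :
    #Q ^ 2 ≤ #N * #{p ∈ Q ×ˢ Q | f p.1 = f p.2} := by
  have h1 : #Q = ∑ n ∈ N, #{q ∈ Q | f q = n} := card_eq_sum_card_fiberwise hf
  have h2 : #{p ∈ Q ×ˢ Q | f p.1 = f p.2} = ∑ n ∈ N, #{q ∈ Q | f q = n} ^ 2 := by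
    rw [card_eq_sum_card_fiberwise (f := fun p => f p.1) (t := N)]
    · refine sum_congr rfl fun n _ => ?_
      rw [sq, ← card_product]
      congr 1
      ext ⟨p, q⟩
      simp only [mem_filter, mem_product]
      constructor
      · rintro ⟨⟨⟨h1, h2⟩, h3⟩, h4⟩
        exact ⟨⟨h1, h4⟩, h2, h3 ▸ h4⟩
      · rintro ⟨⟨h1, h4⟩, h2, h3⟩
        exact ⟨⟨⟨h1, h2⟩, h4.trans h3.symm⟩, h4⟩
    · rintro ⟨p, q⟩ h
      have h := mem_coe.1 h
      simp only [mem_filter, mem_product] at h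
      exact hf _ h.1.1
  rw [h2, h1]
  exact sq_sum_le_card_mul_sum_sq

lemma card_equal_difference_triples_le (A : Finset ℤ) (Q : Finset (ℤ × ℤ × ℤ))
    (hQ : Q ⊆ A ×ˢ A ×ˢ A) :
    #{p ∈ Q ×ˢ Q | (p.1.1 - p.1.2.1, p.1.2.2 - p.1.2.1) = (p.2.1 - p.2.2.1, p.2.2.2 - p.2.2.1)} ≤
      ∑ z ∈ A - A, rep A z ^ 3 := by
  rw [card_eq_sum_card_fiberwise (f := fun p => p.1.1 - p.2.1) (t := A - A)]
  · refine sum_le_sum fun z _ => ?_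
    have : rep A z ^ 3 = #({p ∈ A ×ˢ A | p.1 - p.2 = z} ×ˢ {p ∈ A ×ˢ A | p.1 - p.2 = z} ×ˢ
        {p ∈ A ×ˢ A | p.1 - p.2 = z}) := by
      rw [card_product, card_product]; unfold rep; ring
    rw [this]
    refine card_le_card_of_injOn
      (fun p => ((p.1.1, p.2.1), (p.1.2.1, p.2.2.1), (p.1.2.2, p.2.2.2))) ?_ ?_
    · rintro ⟨⟨a, b, c⟩, ⟨a', b', c'⟩⟩ h
      have h := mem_coe.1 h
      simp only [mem_filter, mem_product, Prod.mk.injEq] at h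
      obtain ⟨⟨⟨hq, hq'⟩, h1, h2⟩, h3⟩ := h
      have hq := hQ hq
      have hq' := hQ hq'
      simp only [mem_product] at hq hq'
      simp only [coe_product, Set.mem_prod, mem_coe, mem_filter, mem_product]
      exact ⟨⟨⟨hq.1, hq'.1⟩, h3⟩, ⟨⟨hq.2.1, hq'.2.1⟩, by linarith⟩,
        ⟨⟨hq.2.2, hq'.2.2⟩, by linarith⟩⟩
    · rintro ⟨⟨a, b, c⟩, ⟨a', b', c'⟩⟩ _ ⟨⟨d, e, f⟩, ⟨d', e', f'⟩⟩ _ h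
      simp only [Prod.mk.injEq] at h ⊢
      tauto
  · rintro ⟨⟨a, b, c⟩, ⟨a', b', c'⟩⟩ h
    have h := mem_coe.1 h
    simp only [mem_filter, mem_product] at h
    have hq := hQ h.1.1
    have hq' := hQ h.1.2
    simp only [mem_product] at hq hq'
    exact sub_mem_sub hq.1 hq'.1

lemma sum_rotate {ι : Type*} (A : Finset ι) (F : ι → ι → ι → ℝ) :
    ∑ a ∈ A, ∑ b ∈ A, ∑ c ∈ A, F b c a = ∑ a ∈ A, ∑ b ∈ A, ∑ c ∈ A, F a b c := by
  rw [sum_comm]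
  exact sum_congr rfl fun b _ => sum_comm

lemma sum_triangle_sq_le {ι : Type*} (A : Finset ι) (G R : ι → ι → ℝ) :
    (∑ a ∈ A, ∑ b ∈ A, ∑ c ∈ A, G a b * R b c * R c a) ^ 2 ≤
      (∑ a ∈ A, ∑ b ∈ A, G a b ^ 2) * (∑ a ∈ A, ∑ b ∈ A, R a b ^ 2) ^ 2 := by
  set Q : ι → ι → ℝ := fun a b => ∑ c ∈ A, R b c * R c a with hQ
  have e : ∑ a ∈ A, ∑ b ∈ A, ∑ c ∈ A, G a b * R b c * R c a
      = ∑ p ∈ A ×ˢ A, G p.1 p.2 * Q p.1 p.2 := by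
    rw [sum_product]
    refine sum_congr rfl fun a _ => sum_congr rfl fun b _ => ?_
    simp only [hQ]
    rw [mul_sum]
    exact sum_congr rfl fun c _ => by ring
  rw [e]
  refine (sum_mul_sq_le_sq_mul_sq _ _ _).trans ?_
  have h1 : ∑ p ∈ A ×ˢ A, G p.1 p.2 ^ 2 = ∑ a ∈ A, ∑ b ∈ A, G a b ^ 2 := sum_product _ _ _
  have h2 : ∑ p ∈ A ×ˢ A, Q p.1 p.2 ^ 2 ≤ (∑ a ∈ A, ∑ b ∈ A, R a b ^ 2) ^ 2 := by
    calc ∑ p ∈ A ×ˢ A, Q p.1 p.2 ^ 2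
        ≤ ∑ p ∈ A ×ˢ A, (∑ c ∈ A, R c p.1 ^ 2) * (∑ c ∈ A, R p.2 c ^ 2) := by
          refine sum_le_sum fun p _ => ?_
          rw [mul_comm]
          exact sum_mul_sq_le_sq_mul_sq _ _ _
      _ = (∑ a ∈ A, ∑ c ∈ A, R c a ^ 2) * ∑ b ∈ A, ∑ c ∈ A, R b c ^ 2 := by
          rw [sum_product, sum_mul_sum]
      _ = _ := by rw [sum_comm, sq]
  rw [h1]
  exact mul_le_mul_of_nonneg_left h2 (sum_nonneg fun _ _ => sum_nonneg fun _ _ => sq_nonneg _)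

lemma rep_sub_eq_sum (A : Finset ℤ) {a b : ℤ} (hb : b ∈ A) :
    (rep A (a - b) : ℝ) =
      ∑ s ∈ A + A, (if s - a ∈ A then (1 : ℝ) else 0) * (if s - b ∈ A then 1 else 0) := by
  have h : ∀ s : ℤ, (if s - a ∈ A then (1 : ℝ) else 0) * (if s - b ∈ A then 1 else 0) =
      if (s - a ∈ A ∧ s - b ∈ A) then 1 else 0 := by
    intro s; split_ifs <;> simp_all
  simp only [h]
  rw [sum_boole]
  unfold rep
  congr 1
  refine card_bij' (fun p _ => b + p.1) (fun s _ => (s - b, s - a)) ?_ ?_ ?_ ?_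
  · rintro ⟨p, q⟩ hp
    simp only [mem_filter, mem_product] at hp ⊢
    refine ⟨add_mem_add hb hp.1.1, ?_, by simpa using hp.1.1⟩
    have : b + p - a = q := by linarith [hp.2]
    rw [this]; exact hp.1.2
  · intro s hs
    simp only [mem_filter, mem_product] at hs ⊢
    exact ⟨⟨hs.2.2, hs.2.1⟩, by ring⟩
  · rintro ⟨p, q⟩ hp
    simp only [mem_filter, mem_product] at hp ⊢
    ext
    · simp
    · simp; linarith [hp.2]
  · intro s hs; simp

lemma sum_rep_sq_le (A : Finset ℤ) {M ν : ℝ} (hM : 0 < M) (hν0 : 0 < ν) (hν : ν ^ 3 = #A)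
    (h4 : ∑ a ∈ A, ∑ b ∈ A, (rep A (a - b) : ℝ) ^ 3 ≤ M * ν ^ 12) :
    ∑ a ∈ A, ∑ b ∈ A, (rep A (a - b) : ℝ) ^ 2 ≤ M * ν ^ 10 := by
  set s1 := ∑ p ∈ A ×ˢ A, (rep A (p.1 - p.2) : ℝ) with hs1
  set s2 := ∑ p ∈ A ×ˢ A, (rep A (p.1 - p.2) : ℝ) ^ 2 with hs2
  set s3 := ∑ p ∈ A ×ˢ A, (rep A (p.1 - p.2) : ℝ) ^ 3 with hs3
  have e2 : ∑ a ∈ A, ∑ b ∈ A, (rep A (a - b) : ℝ) ^ 2 = s2 := (sum_product' _ _ _).symm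
  have e3 : ∑ a ∈ A, ∑ b ∈ A, (rep A (a - b) : ℝ) ^ 3 = s3 := (sum_product' _ _ _).symm
  rw [e2]; rw [e3] at h4
  have p1 : 0 ≤ s1 := by positivity
  have p2 : 0 ≤ s2 := by positivity
  have p3 : 0 ≤ s3 := by positivity
  have c1 : s1 ^ 2 ≤ ν ^ 6 * s2 := by
    have := sq_sum_le_card_mul_sum_sq (s := A ×ˢ A) (f := fun p => (rep A (p.1 - p.2) : ℝ))
    rw [card_product] at this
    push_cast at this
    rw [← hν] at this
    calc s1 ^ 2 ≤ _ := this
      _ = _ := by ring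
  have c2 : s2 ^ 2 ≤ s1 * s3 := by
    have := sum_sq_le_sum_mul_sum_of_sq_le_mul (A ×ˢ A)
      (r := fun p => (rep A (p.1 - p.2) : ℝ) ^ 2) (f := fun p => (rep A (p.1 - p.2) : ℝ))
      (g := fun p => (rep A (p.1 - p.2) : ℝ) ^ 3)
      (fun _ _ => by positivity) (fun _ _ => by positivity) (fun _ _ => le_of_eq (by ring))
    exact this
  by_contra hcon
  push Not at hcon
  have hpos : 0 < s2 := lt_of_le_of_lt (by positivity) hcon
  have c3 : s2 ^ 4 ≤ ν ^ 6 * s2 * (M * ν ^ 12) ^ 2 := by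
    calc s2 ^ 4 = (s2 ^ 2) ^ 2 := by ring
      _ ≤ (s1 * s3) ^ 2 := by gcongr
      _ = s1 ^ 2 * s3 ^ 2 := by ring
      _ ≤ _ := by gcongr
  have c4 : s2 ^ 3 ≤ M ^ 2 * ν ^ 30 := by
    have : s2 * s2 ^ 3 ≤ s2 * (M ^ 2 * ν ^ 30) := by
      calc s2 * s2 ^ 3 = s2 ^ 4 := by ring
        _ ≤ _ := c3
        _ = _ := by ring
    exact le_of_mul_le_mul_left this hpos
  have c5 : (M * ν ^ 10) ^ 3 < s2 ^ 3 := pow_lt_pow_left₀ hcon (by positivity) (by norm_num)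
  have c5' : M ^ 3 * ν ^ 30 < s2 ^ 3 := by
    calc M ^ 3 * ν ^ 30 = (M * ν ^ 10) ^ 3 := by ring
      _ < _ := c5
  -- contradiction when `1 ≤ M`; when `M < 1` the diagonal term is too large
  have hA : (1 : ℝ) ≤ #A := by
    have : (0 : ℝ) < #A := by rw [← hν]; positivity
    exact_mod_cast this
  have hs3 : ν ^ 12 ≤ s3 := by
    rw [← e3]
    calc ν ^ 12 = ∑ a ∈ A, (#A : ℝ) ^ 3 := by rw [sum_const, nsmul_eq_mul, ← hν]; ring
      _ ≤ _ := by
        refine sum_le_sum fun a ha => ?_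
        refine le_trans (le_of_eq ?_) (single_le_sum (f := fun b => (rep A (a - b) : ℝ) ^ 3)
          (fun _ _ => by positivity) ha)
        simp only [sub_self]
        rw [rep_eq_card]; simp
  have hM1 : 1 ≤ M := by
    have : 1 * ν ^ 12 ≤ M * ν ^ 12 := by linarith
    exact le_of_mul_le_mul_right this (by positivity)
  have : M ^ 2 * ν ^ 30 ≤ M ^ 3 * ν ^ 30 := by gcongr; simp
  linarith

/-- A set of moderately popular differences with many additive triples. -/
lemma exists_popular (A : Finset ℤ) {M ν : ℝ} (hM : 144 ≤ M) (hν0 : 0 < ν) (hν : ν ^ 3 = #A)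
    (hE : ν ^ 8 / M ≤ _root_.addEnergy A)
    (h4 : ∑ x ∈ A - A, (rep A x : ℝ) ^ 4 ≤ M * ν ^ 12) :
    ∃ D : Finset ℤ, (∀ x ∈ D, ν ^ 2 / (6 * M) ≤ rep A x) ∧ (#D : ℝ) ≤ 6 * M * ν ^ 4 ∧
      ν ^ 8 / M ^ 68 ≤ #{p ∈ D ×ˢ D | p.1 - p.2 ∈ D} := by
  have hM0 : 0 < M := by linarith
  set R : ℤ → ℤ → ℝ := fun a b => (rep A (a - b) : ℝ) with hR
  have hR0 : ∀ a b, 0 ≤ R a b := fun a b => by positivity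
  have hsymm : ∀ a b, R a b = R b a := fun a b => by
    simp only [hR]; rw [← rep_neg, neg_sub]
  set θ := ν ^ 2 / (6 * M) with hθ
  set Θ := M ^ 10 * ν ^ 2 with hΘ
  have hθ0 : 0 < θ := by positivity
  have hΘ0 : 0 < Θ := by positivity
  set D := {x ∈ A - A | θ ≤ rep A x ∧ (rep A x : ℝ) ≤ Θ} with hD
  have hDneg : ∀ x, -x ∈ D → x ∈ D := by
    intro x hx
    simp only [hD, mem_filter, rep_neg] at hx ⊢
    refine ⟨?_, hx.2⟩
    obtain ⟨a, ha, b, hb, h⟩ := mem_sub.1 hx.1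
    have : x = b - a := by linarith
    rw [this]; exact sub_mem_sub hb ha
  have hs3 : ∑ a ∈ A, ∑ b ∈ A, R a b ^ 3 ≤ M * ν ^ 12 := by
    refine le_trans (le_of_eq ?_) h4
    rw [sum_pairs_rep A (fun x => (rep A x : ℝ) ^ 3)]
    exact sum_congr rfl fun x _ => by ring
  have hs2 : ∑ a ∈ A, ∑ b ∈ A, R a b ^ 2 ≤ M * ν ^ 10 := sum_rep_sq_le A hM0 hν0 hν hs3
  rw [addEnergy_eq] at hE
  change ν ^ 8 / M ≤ ∑ a ∈ A, ∑ b ∈ A, R a b at hE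
  set m1 := ∑ a ∈ A, ∑ b ∈ A, R a b with hm1
  have hm1pos : 0 < m1 := lt_of_lt_of_le (by positivity) hE
  set m2 := ∑ b ∈ A, (∑ a ∈ A, R a b) ^ 2 with hm2
  set τ := ∑ a ∈ A, ∑ b ∈ A, ∑ c ∈ A, R a b * R b c * R c a with hτ
  have ht : m2 * m1 ≤ ν ^ 6 * τ := by
    have := trace_cube_ge (A.attach) (A + A)
      (fun (a : A) s => if s - (a : ℤ) ∈ A then (1 : ℝ) else 0) (fun a b => R a b)
      (fun a b => rep_sub_eq_sum A b.2) (by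
        rw [sum_attach A (fun a => ∑ b ∈ A.attach, R a b)]
        simp only [fun a => sum_attach A (fun b => R a b)]
        exact hm1pos)
    rw [card_attach, sum_attach A (fun a => ∑ b ∈ A.attach, R a b),
      sum_attach A (fun b => (∑ a ∈ A.attach, R a b) ^ 2),
      sum_attach A (fun a => ∑ b ∈ A.attach, ∑ c ∈ A.attach, R a b * R b c * R c a)] at this
    simp only [fun a => sum_attach A (fun b => R a b),
      fun b => sum_attach A (fun a => R a b),
      fun a => sum_attach A (fun b => ∑ c ∈ A, R a b * R b c * R c a),
      fun a b => sum_attach A (fun c => R a b * R b c * R c a)] at this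
    calc m2 * m1 ≤ _ := this
      _ = ν ^ 6 * τ := by rw [← hν]; ring
  have hm2m1 : m1 ^ 2 ≤ ν ^ 3 * m2 := by
    rw [hm1, sum_comm, hν]
    exact sq_sum_le_card_mul_sum_sq
  have hm2pos : 0 ≤ m2 := sum_nonneg fun _ _ => sq_nonneg _
  have hlow : 3 * (θ * m2) ≤ τ / 2 := by
    have : m2 * (ν ^ 8 / M) ≤ ν ^ 6 * τ := le_trans (by gcongr) ht
    have h2 : ν ^ 6 * (3 * (θ * m2)) ≤ ν ^ 6 * (τ / 2) := by
      calc ν ^ 6 * (3 * (θ * m2)) = (m2 * (ν ^ 8 / M)) / 2 := by rw [hθ]; field_simp; ring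
        _ ≤ ν ^ 6 * τ / 2 := by linarith
        _ = _ := by ring
    exact le_of_mul_le_mul_left h2 (by positivity)
  have hτ0 : ν ^ 15 / M ^ 3 ≤ τ := by
    have h1 : m1 ^ 3 ≤ ν ^ 9 * τ := by
      calc m1 ^ 3 = m1 ^ 2 * m1 := by ring
        _ ≤ ν ^ 3 * m2 * m1 := by gcongr
        _ = ν ^ 3 * (m2 * m1) := by ring
        _ ≤ ν ^ 3 * (ν ^ 6 * τ) := by gcongr
        _ = _ := by ring
    have h2 : (ν ^ 8 / M) ^ 3 ≤ m1 ^ 3 := by gcongr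
    have h3 : ν ^ 9 * (ν ^ 15 / M ^ 3) ≤ ν ^ 9 * τ := by
      calc ν ^ 9 * (ν ^ 15 / M ^ 3) = (ν ^ 8 / M) ^ 3 := by field_simp
        _ ≤ _ := h2.trans h1
    exact le_of_mul_le_mul_left h3 (by positivity)
  set G : ℤ → ℤ → ℝ := fun a b => if R a b ≤ Θ then 0 else R a b with hG
  have hG0 : ∀ a b, 0 ≤ G a b := fun a b => by
    simp only [hG]; split_ifs; exacts [le_rfl, hR0 a b]
  have hG2 : ∑ a ∈ A, ∑ b ∈ A, G a b ^ 2 ≤ ν ^ 10 / M ^ 9 := by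
    have h1 : Θ * ∑ a ∈ A, ∑ b ∈ A, G a b ^ 2 ≤ ∑ a ∈ A, ∑ b ∈ A, R a b ^ 3 := by
      rw [mul_sum]
      refine sum_le_sum fun a _ => ?_
      rw [mul_sum]
      refine sum_le_sum fun b _ => ?_
      simp only [hG]
      split_ifs with h
      · have := hR0 a b
        simp; positivity
      · push Not at h
        calc Θ * R a b ^ 2 ≤ R a b * R a b ^ 2 := by gcongr
          _ = _ := by ring
    have h2 : Θ * ∑ a ∈ A, ∑ b ∈ A, G a b ^ 2 ≤ Θ * (ν ^ 10 / M ^ 9) := by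
      calc _ ≤ _ := h1.trans hs3
        _ = _ := by rw [hΘ]; field_simp
    exact le_of_mul_le_mul_left h2 hΘ0
  set hh := ∑ a ∈ A, ∑ b ∈ A, ∑ c ∈ A, G a b * R b c * R c a with hhh
  have hhigh : 3 * hh ≤ τ / 4 := by
    have hs20 : 0 ≤ ∑ a ∈ A, ∑ b ∈ A, R a b ^ 2 :=
      sum_nonneg fun _ _ => sum_nonneg fun _ _ => sq_nonneg _
    have h1 : hh ^ 2 ≤ (ν ^ 15 / (12 * M ^ 3)) ^ 2 := by
      calc hh ^ 2 ≤ _ := sum_triangle_sq_le A G R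
        _ ≤ (ν ^ 10 / M ^ 9) * (M * ν ^ 10) ^ 2 := by gcongr
        _ = 144 * (ν ^ 30 / (144 * M ^ 7)) := by field_simp
        _ ≤ M * (ν ^ 30 / (144 * M ^ 7)) := by gcongr
        _ = _ := by field_simp; norm_num
    have h2 : hh ≤ ν ^ 15 / (12 * M ^ 3) := (le_abs_self _).trans (abs_le_of_sq_le_sq h1 (by positivity))
    have h3 : 3 * (ν ^ 15 / (12 * M ^ 3)) = ν ^ 15 / M ^ 3 / 4 := by field_simp; norm_num
    linarith
  set Q := {t ∈ A ×ˢ A ×ˢ A | t.1 - t.2.1 ∈ D ∧ t.2.1 - t.2.2 ∈ D ∧ t.2.2 - t.1 ∈ D} with hQ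
  have hsplit : τ ≤ #Q * Θ ^ 3 + 3 * (θ * m2) + 3 * hh := by
    have hmem : ∀ a ∈ A, ∀ b ∈ A, ¬ (R a b < θ) → R a b ≤ Θ → a - b ∈ D := by
      intro a ha b hb h1 h2
      simp only [hD, mem_filter]
      exact ⟨sub_mem_sub ha hb, not_lt.1 h1, h2⟩
    set F : ℤ → ℤ → ℤ → ℝ := fun a b c => θ * (R b c * R c a) + G a b * R b c * R c a with hF
    have hF0 : ∀ a b c, 0 ≤ F a b c := fun a b c => by
      have := hR0 b c; have := hR0 c a; have := hG0 a b
      simp only [hF]; positivity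
    have hpt : ∀ a ∈ A, ∀ b ∈ A, ∀ c ∈ A, R a b * R b c * R c a ≤
        (if (a - b ∈ D ∧ b - c ∈ D ∧ c - a ∈ D) then Θ ^ 3 else 0) + F a b c + F b c a
          + F c a b := by
      have hF1 : ∀ a ∈ A, ∀ b ∈ A, ∀ c ∈ A, a - b ∉ D → R a b * R b c * R c a ≤ F a b c := by
        intro a ha b hb c hc hab
        have p1 := hR0 b c
        have p2 := hR0 c a
        have p3 := hR0 a b
        simp only [hF]
        by_cases h1 : R a b < θ
        · have : R a b * (R b c * R c a) ≤ θ * (R b c * R c a) := by gcongr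
          have p4 : 0 ≤ G a b * R b c * R c a := by have := hG0 a b; positivity
          linarith
        · have h2 : ¬ (R a b ≤ Θ) := fun h2 => hab (hmem a ha b hb h1 h2)
          have : G a b = R a b := by simp only [hG]; rw [if_neg h2]
          rw [this]
          have : 0 ≤ θ * (R b c * R c a) := by positivity
          linarith
      intro a ha b hb c hc
      have q1 := hF0 a b c
      have q2 := hF0 b c a
      have q3 := hF0 c a b
      by_cases hab : a - b ∈ D
      · by_cases hbc : b - c ∈ D
        · by_cases hca : c - a ∈ D
          · rw [if_pos ⟨hab, hbc, hca⟩]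
            have r1 : R a b ≤ Θ := (mem_filter.1 hab).2.2
            have r2 : R b c ≤ Θ := (mem_filter.1 hbc).2.2
            have r3 : R c a ≤ Θ := (mem_filter.1 hca).2.2
            have : R a b * R b c * R c a ≤ Θ * Θ * Θ := by
              have := hR0 a b; have := hR0 b c; have := hR0 c a
              gcongr
            have : Θ ^ 3 = Θ * Θ * Θ := by ring
            linarith
          · rw [if_neg (by tauto)]
            have := hF1 c hc a ha b hb hca
            have e : R c a * R a b * R b c = R a b * R b c * R c a := by ring
            linarith
        · rw [if_neg (by tauto)]
          have := hF1 b hb c hc a ha hbc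
          have e : R b c * R c a * R a b = R a b * R b c * R c a := by ring
          linarith
      · rw [if_neg (by tauto)]
        have := hF1 a ha b hb c hc hab
        linarith
    have hFsum : ∑ a ∈ A, ∑ b ∈ A, ∑ c ∈ A, F a b c = θ * m2 + hh := by
      simp only [hF, sum_add_distrib]
      congr 1
      rw [sum_rotate A (fun a b c => θ * (R a b * R b c)) |>.symm.symm]
      rw [sum_comm, hm2, mul_sum]
      refine sum_congr rfl fun b _ => ?_
      rw [sq, sum_mul_sum, mul_sum]
      refine sum_congr rfl fun a _ => ?_
      rw [mul_sum]
      refine sum_congr rfl fun c _ => ?_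
      rw [hsymm b c]
    have hQsum : ∑ a ∈ A, ∑ b ∈ A, ∑ c ∈ A,
        (if (a - b ∈ D ∧ b - c ∈ D ∧ c - a ∈ D) then Θ ^ 3 else 0) = #Q * Θ ^ 3 := by
      rw [hQ, ← nsmul_eq_mul, ← sum_const, sum_filter, sum_product]
      refine sum_congr rfl fun a _ => ?_
      rw [sum_product]
    calc τ ≤ ∑ a ∈ A, ∑ b ∈ A, ∑ c ∈ A,
          ((if (a - b ∈ D ∧ b - c ∈ D ∧ c - a ∈ D) then Θ ^ 3 else 0) + F a b c + F b c a
          + F c a b) :=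
          sum_le_sum fun a ha => sum_le_sum fun b hb => sum_le_sum fun c hc => hpt a ha b hb c hc
      _ = #Q * Θ ^ 3 + (θ * m2 + hh) + (θ * m2 + hh) + (θ * m2 + hh) := by
          simp only [sum_add_distrib]
          rw [hQsum]
          have e1 := sum_rotate A F
          have e2 := sum_rotate A (fun a b c => F b c a)
          rw [e2, e1, hFsum]
      _ = _ := by ring
  have hQcard : ν ^ 9 / (4 * M ^ 33) ≤ #Q := by
    have h1 : ν ^ 15 / M ^ 3 / 4 ≤ #Q * Θ ^ 3 := by linarith
    have h2 : Θ ^ 3 * (ν ^ 9 / (4 * M ^ 33)) ≤ Θ ^ 3 * #Q := by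
      calc Θ ^ 3 * (ν ^ 9 / (4 * M ^ 33)) = ν ^ 15 / M ^ 3 / 4 := by
            rw [hΘ]; field_simp
        _ ≤ _ := by linarith
    exact le_of_mul_le_mul_left h2 (by positivity)
  refine ⟨D, fun x hx => (mem_filter.1 hx).2.1, ?_, ?_⟩
  · have h1 : (#D : ℝ) * θ ≤ (#A : ℝ) ^ 2 := by
      calc (#D : ℝ) * θ = ∑ x ∈ D, θ := by simp
        _ ≤ ∑ x ∈ D, (rep A x : ℝ) := sum_le_sum fun x hx => (mem_filter.1 hx).2.1
        _ ≤ ∑ x ∈ A - A, (rep A x : ℝ) :=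
            sum_le_sum_of_subset_of_nonneg (filter_subset _ _) fun _ _ _ => by positivity
        _ = ∑ a ∈ A, ∑ b ∈ A, (1 : ℝ) := by
            rw [sum_pairs_rep A (fun _ => 1)]; simp
        _ = _ := by simp; ring
    have h2 : (#D : ℝ) * θ ≤ (6 * M * ν ^ 4) * θ := by
      calc _ ≤ _ := h1
        _ = _ := by rw [← hν, hθ]; field_simp
    exact le_of_mul_le_mul_right h2 hθ0
  · have h1 := sq_card_le_card_mul_card_pairs Q {p ∈ D ×ˢ D | p.1 - p.2 ∈ D}
      (fun t => (t.1 - t.2.1, t.2.2 - t.2.1)) (by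
        rintro ⟨a, b, c⟩ h
        simp only [hQ, mem_filter, mem_product] at h ⊢
        refine ⟨⟨h.2.1, hDneg _ (by simpa using h.2.2.1)⟩, hDneg _ ?_⟩
        have : -(a - b - (c - b)) = c - a := by ring
        rw [this]; exact h.2.2.2)
    have h2 := card_equal_difference_triples_le A Q (filter_subset _ _)
    have h3 : (#Q : ℝ) ^ 2 ≤ #{p ∈ D ×ˢ D | p.1 - p.2 ∈ D} * (M * ν ^ 10) := by
      calc (#Q : ℝ) ^ 2 ≤ (#{p ∈ D ×ˢ D | p.1 - p.2 ∈ D} * ∑ z ∈ A - A, rep A z ^ 3 : ℕ) := by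
            exact_mod_cast h1.trans (Nat.mul_le_mul_left _ h2)
        _ = #{p ∈ D ×ˢ D | p.1 - p.2 ∈ D} * ∑ z ∈ A - A, (rep A z : ℝ) ^ 3 := by push_cast; rfl
        _ ≤ _ := by
            gcongr
            refine le_trans (le_of_eq ?_) hs2
            rw [sum_pairs_rep A (fun x => (rep A x : ℝ) ^ 2)]
            exact sum_congr rfl fun x _ => by ring
    have h4 : (ν ^ 8 / M ^ 68) * (M * ν ^ 10) ≤
        #{p ∈ D ×ˢ D | p.1 - p.2 ∈ D} * (M * ν ^ 10) := by
      calc (ν ^ 8 / M ^ 68) * (M * ν ^ 10) = 16 * (ν ^ 18 / (16 * M ^ 67)) := by field_simp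
        _ ≤ M * (ν ^ 18 / (16 * M ^ 67)) := by gcongr; linarith
        _ = (ν ^ 9 / (4 * M ^ 33)) ^ 2 := by field_simp; norm_num
        _ ≤ (#Q : ℝ) ^ 2 := by gcongr
        _ ≤ _ := h3
    exact le_of_mul_le_mul_right h4 (by positivity)

/-- Some neighbourhood in a dense graph has few pairs of small codegree. -/
lemma exists_neighborhood {α : Type*} (D : Finset α) (r : α → α → Prop)
    [∀ x y, Decidable (r x y)] {κ : ℝ} (hκ : 0 < κ) (hD : D.Nonempty)
    (h : κ * (#D : ℝ) ^ 2 ≤ ∑ y ∈ D, (#{x ∈ D | r x y} : ℝ)) :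
    ∃ X ⊆ D, κ * #D / 2 ≤ #X ∧
      ∑ x ∈ X, (#{x' ∈ X | (#{y ∈ D | r x y ∧ r x' y} : ℝ) < κ ^ 2 / 16 * #D} : ℝ)
        ≤ (#X : ℝ) ^ 2 / 8 := by
  have hv : 0 < (#D : ℝ) := by exact_mod_cast hD.card_pos
  set N : α → Finset α := fun y => {x ∈ D | r x y} with hN
  set bad : α → α → Prop := fun x x' =>
    (#{y ∈ D | r x y ∧ r x' y} : ℝ) < κ ^ 2 / 16 * #D with hbad
  have hcs : κ ^ 2 * (#D : ℝ) ^ 3 ≤ ∑ y ∈ D, (#(N y) : ℝ) ^ 2 := by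
    have h1 := sq_sum_le_card_mul_sum_sq (s := D) (f := fun y => (#(N y) : ℝ))
    have h2 : (κ * (#D : ℝ) ^ 2) ^ 2 ≤ (∑ y ∈ D, (#(N y) : ℝ)) ^ 2 := by gcongr
    have h3 : (#D : ℝ) * (κ ^ 2 * (#D : ℝ) ^ 3) ≤ #D * ∑ y ∈ D, (#(N y) : ℝ) ^ 2 := by
      calc _ = (κ * (#D : ℝ) ^ 2) ^ 2 := by ring
        _ ≤ _ := h2.trans h1
    exact le_of_mul_le_mul_left h3 hv
  have hb : ∑ y ∈ D, ∑ x ∈ N y, (#{x' ∈ N y | bad x x'} : ℝ) ≤ κ ^ 2 / 16 * (#D : ℝ) ^ 3 := by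
    have e : ∀ y ∈ D, ∑ x ∈ N y, (#{x' ∈ N y | bad x x'} : ℝ) =
        ∑ x ∈ D, ∑ x' ∈ D, if bad x x' then (if r x y ∧ r x' y then (1 : ℝ) else 0) else 0 := by
      intro y _
      simp only [hN]
      rw [sum_filter]
      refine sum_congr rfl fun x _ => ?_
      rw [filter_filter, card_filter]
      push_cast
      by_cases hx : r x y
      · rw [if_pos hx]
        refine sum_congr rfl fun x' _ => ?_
        simp only [hx, true_and]
        split_ifs <;> tauto
      · rw [if_neg hx]
        symm
        refine sum_eq_zero fun x' _ => ?_
        simp only [hx, false_and, if_false, ite_self]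
    rw [sum_congr rfl e, sum_comm]
    calc ∑ x ∈ D, ∑ y ∈ D, ∑ x' ∈ D,
          (if bad x x' then (if r x y ∧ r x' y then (1 : ℝ) else 0) else 0)
        ≤ ∑ x ∈ D, ∑ x' ∈ D, κ ^ 2 / 16 * (#D : ℝ) := by
          refine sum_le_sum fun x _ => ?_
          rw [sum_comm]
          refine sum_le_sum fun x' _ => ?_
          by_cases h1 : bad x x'
          · simp only [if_pos h1]
            rw [← sum_filter, sum_const, nsmul_eq_mul, mul_one]
            exact h1.le
          · simp only [if_neg h1, sum_const_zero]
            positivity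
      _ = _ := by simp; ring
  have hex : ∀ B : α → ℝ, ∑ y ∈ D, B y ≤ κ ^ 2 / 16 * (#D : ℝ) ^ 3 →
      ∃ y ∈ D, κ ^ 2 * (#D : ℝ) ^ 2 / 2 ≤ (#(N y) : ℝ) ^ 2 - 8 * B y := by
    intro B hB
    refine exists_le_of_sum_le hD ?_
    rw [sum_sub_distrib, ← mul_sum, sum_const, nsmul_eq_mul]
    linarith [show (#D : ℝ) * (κ ^ 2 * (#D : ℝ) ^ 2 / 2) = κ ^ 2 * (#D : ℝ) ^ 3 / 2 by ring]
  obtain ⟨y, hy, hyb⟩ := hex _ hb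
  have h0 : 0 ≤ ∑ x ∈ N y, (#{x' ∈ N y | bad x x'} : ℝ) := sum_nonneg fun _ _ => Nat.cast_nonneg _
  refine ⟨N y, filter_subset _ _, ?_, ?_⟩
  · have : (κ * #D / 2) ^ 2 ≤ (#(N y) : ℝ) ^ 2 := by
      have : 0 ≤ κ ^ 2 * (#D : ℝ) ^ 2 := by positivity
      have e : (κ * #D / 2) ^ 2 = κ ^ 2 * (#D : ℝ) ^ 2 / 4 := by ring
      linarith
    exact (le_abs_self _).trans (abs_le_of_sq_le_sq this (by positivity))
  · have : 0 ≤ κ ^ 2 * (#D : ℝ) ^ 2 / 2 := by positivity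
    change ∑ x ∈ N y, (#{x' ∈ N y | bad x x'} : ℝ) ≤ _
    linarith

/-- A form of the Balog--Szemerédi--Gowers theorem. -/
lemma exists_small_difference (D : Finset ℤ) {κ : ℝ} (hκ : 0 < κ) (hD : D.Nonempty)
    (h : κ * (#D : ℝ) ^ 2 ≤ #{p ∈ D ×ˢ D | p.1 - p.2 ∈ D}) :
    ∃ P ⊆ D, κ * #D / 4 ≤ #P ∧ (#(P - P) : ℝ) * κ ^ 5 ≤ 1024 * #D := by
  have hv : 0 < (#D : ℝ) := by exact_mod_cast hD.card_pos
  obtain ⟨X, hXD, hX, hXb⟩ := exists_neighborhood D (fun x y => x - y ∈ D) hκ hD (by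
    refine h.trans (le_of_eq ?_)
    rw [card_filter, sum_product, sum_comm]
    push_cast
    refine sum_congr rfl fun y _ => ?_
    rw [card_filter]; push_cast; rfl)
  set cd : ℤ → ℤ → Finset ℤ := fun x x' => {y ∈ D | x - y ∈ D ∧ x' - y ∈ D} with hcd
  set η := κ ^ 2 / 16 * (#D : ℝ) with hη
  have hη0 : 0 < η := by positivity
  have hX0 : 0 < (#X : ℝ) := lt_of_lt_of_le (by positivity) hX
  set b : ℤ → ℝ := fun x => (#{x' ∈ X | (#(cd x x') : ℝ) < η} : ℝ) with hb
  set P := {x ∈ X | b x ≤ #X / 4} with hP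
  have hPX : (#X : ℝ) / 2 ≤ #P := by
    have h1 : (#{x ∈ X | ¬ b x ≤ #X / 4} : ℝ) * (#X / 4) ≤ (#X : ℝ) ^ 2 / 8 := by
      calc (#{x ∈ X | ¬ b x ≤ #X / 4} : ℝ) * (#X / 4)
          = ∑ x ∈ X with ¬ b x ≤ #X / 4, (#X / 4 : ℝ) := by simp
        _ ≤ ∑ x ∈ X with ¬ b x ≤ #X / 4, b x :=
            sum_le_sum fun x hx => (not_le.1 (mem_filter.1 hx).2).le
        _ ≤ ∑ x ∈ X, b x :=
            sum_le_sum_of_subset_of_nonneg (filter_subset _ _) fun _ _ _ => by positivity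
        _ ≤ _ := hXb
    have h2 : (#P : ℝ) + #{x ∈ X | ¬ b x ≤ #X / 4} = #X := by
      exact_mod_cast card_filter_add_card_filter_not (s := X) (fun x => b x ≤ #X / 4)
    have h3 : (#{x ∈ X | ¬ b x ≤ #X / 4} : ℝ) ≤ #X / 2 := by
      refine le_of_not_gt fun hc => ?_
      nlinarith
    linarith
  refine ⟨P, (filter_subset _ _).trans hXD, by linarith, ?_⟩
  set q : Finset (ℤ × ℤ × ℤ × ℤ) := D ×ˢ D ×ˢ D ×ˢ D with hq
  set f : ℤ × ℤ × ℤ × ℤ → ℤ := fun p => p.1 - p.2.1 + (p.2.2.1 - p.2.2.2) with hf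
  have hfib : ∀ z ∈ P - P, (#X / 2 : ℝ) * η ^ 2 ≤ #{p ∈ q | f p = z} := by
    intro z hz
    obtain ⟨x, hx, w, hw, rfl⟩ := mem_sub.1 hz
    set G := {x' ∈ X | η ≤ #(cd x x') ∧ η ≤ #(cd w x')} with hG
    have hGc : (#X : ℝ) / 2 ≤ #G := by
      have hsub : X ⊆ G ∪ {x' ∈ X | (#(cd x x') : ℝ) < η} ∪ {x' ∈ X | (#(cd w x') : ℝ) < η} := by
        intro x' hx'
        simp only [hG, mem_union, mem_filter, hx', true_and]
        by_cases h1 : η ≤ #(cd x x')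
        · by_cases h2 : η ≤ #(cd w x')
          · exact Or.inl (Or.inl ⟨h1, h2⟩)
          · exact Or.inr (not_le.1 h2)
        · exact Or.inl (Or.inr (not_le.1 h1))
      have h1 : (#X : ℝ) ≤ #G + b x + b w := by
        have h2 := (card_le_card hsub).trans ((card_union_le _ _).trans
          (Nat.add_le_add_right (card_union_le _ _) _))
        have h3 : (#X : ℝ) ≤ ((#G + #{x' ∈ X | (#(cd x x') : ℝ) < η} +
          #{x' ∈ X | (#(cd w x') : ℝ) < η} : ℕ) : ℝ) := by exact_mod_cast h2
        push_cast at h3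
        exact h3
      have h2 := (mem_filter.1 hx).2
      have h3 := (mem_filter.1 hw).2
      linarith
    set T := G.sigma fun x' => cd x x' ×ˢ cd w x' with hT
    have hTc : (#X / 2 : ℝ) * η ^ 2 ≤ #T := by
      rw [hT, card_sigma]
      push_cast
      calc (#X / 2 : ℝ) * η ^ 2 ≤ #G * η ^ 2 := by gcongr
        _ = ∑ x' ∈ G, η ^ 2 := by simp
        _ ≤ _ := by
          refine sum_le_sum fun x' hx' => ?_
          have h1 := (mem_filter.1 hx').2
          rw [card_product, sq]; push_cast
          exact mul_le_mul h1.1 h1.2 hη0.le (by positivity)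
    refine hTc.trans ?_
    norm_cast
    refine card_le_card_of_injOn
      (fun t => (x - t.2.1, t.1 - t.2.1, t.1 - t.2.2, w - t.2.2)) ?_ ?_
    · rintro ⟨x', y1, y2⟩ ht
      simp only [hT, hcd, mem_coe, mem_sigma, mem_product, mem_filter] at ht
      simp only [hq, hf, mem_coe, mem_filter, mem_product]
      exact ⟨⟨ht.2.1.2.1, ht.2.1.2.2, ht.2.2.2.2, ht.2.2.2.1⟩, by ring⟩
    · rintro ⟨x', y1, y2⟩ _ ⟨x'', y1', y2'⟩ _ he
      simp only [Prod.mk.injEq] at he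
      obtain ⟨h1, h2, h3, h4⟩ := he
      have e1 : y1 = y1' := by linarith
      have e2 : y2 = y2' := by linarith
      have e3 : x' = x'' := by linarith
      subst e1 e2 e3; rfl
  have hsum : (#(P - P) : ℝ) * (#X / 2 * η ^ 2) ≤ (#D : ℝ) ^ 4 := by
    calc (#(P - P) : ℝ) * (#X / 2 * η ^ 2) = ∑ z ∈ P - P, (#X / 2 : ℝ) * η ^ 2 := by
          rw [sum_const, nsmul_eq_mul]
      _ ≤ ∑ z ∈ P - P, (#{p ∈ q | f p = z} : ℝ) := sum_le_sum hfib
      _ ≤ (#q : ℝ) := by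
          have := sum_card_fiberwise_eq_card_filter q (P - P) f
          have h2 := this.le.trans (card_filter_le _ _)
          exact_mod_cast h2
      _ = _ := by simp only [hq, card_product]; push_cast; ring
  have h1 : (#(P - P) : ℝ) * κ ^ 5 * ((#D : ℝ) ^ 3 / 1024) ≤ 1024 * #D * ((#D : ℝ) ^ 3 / 1024) := by
    calc (#(P - P) : ℝ) * κ ^ 5 * ((#D : ℝ) ^ 3 / 1024)
        = (#(P - P) : ℝ) * ((κ * #D / 2) / 2 * η ^ 2) := by rw [hη]; ring
      _ ≤ (#(P - P) : ℝ) * (#X / 2 * η ^ 2) := by gcongr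
      _ ≤ (#D : ℝ) ^ 4 := hsum
      _ = _ := by ring
  exact le_of_mul_le_mul_right h1 (by positivity)

/-- A one-sided Chernoff bound for the uniform measure on tuples. -/
lemma card_sum_gt_le {α : Type*} (P : Finset α) (g : α → ℝ) (hg : ∀ b ∈ P, |g b| ≤ 1)
    (hg0 : ∑ b ∈ P, g b = 0) (m : ℕ) {ε : ℝ} (hε : 0 ≤ ε) (hε1 : ε ≤ 1) :
    (#{b ∈ Fintype.piFinset fun _ : Fin m => P | m * ε < ∑ i, g (b i)} : ℝ)
      ≤ Real.exp (-(m * ε ^ 2 / 4)) * (#P : ℝ) ^ m := by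
  have h1 : ∑ b ∈ P, Real.exp (ε / 2 * g b) ≤ #P * Real.exp (ε ^ 2 / 4) := by
    calc ∑ b ∈ P, Real.exp (ε / 2 * g b) ≤ ∑ b ∈ P, (1 + ε / 2 * g b + ε ^ 2 / 4) := by
          refine sum_le_sum fun b hb => ?_
          have hu : |ε / 2 * g b| ≤ ε / 2 := by
            rw [abs_mul, abs_of_nonneg (by positivity : 0 ≤ ε / 2)]
            exact mul_le_of_le_one_right (by positivity) (hg b hb)
          have h2 := (abs_le.1 (Real.abs_exp_sub_one_sub_id_le (x := ε / 2 * g b)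
            (by linarith))).2
          have h3 : (ε / 2 * g b) ^ 2 ≤ (ε / 2) ^ 2 := sq_le_sq' (abs_le.1 hu).1 (abs_le.1 hu).2
          linarith [show (ε / 2) ^ 2 = ε ^ 2 / 4 by ring]
      _ = #P * (ε ^ 2 / 4 + 1) := by
          rw [sum_add_distrib, sum_add_distrib, ← mul_sum, hg0]
          simp; ring
      _ ≤ _ := by gcongr; exact Real.add_one_le_exp _
  have h2 : (#{b ∈ Fintype.piFinset fun _ : Fin m => P | m * ε < ∑ i, g (b i)} : ℝ) *
      Real.exp (m * ε ^ 2 / 2) ≤ (#P * Real.exp (ε ^ 2 / 4)) ^ m := by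
    calc _ = ∑ b ∈ Fintype.piFinset (fun _ : Fin m => P) with m * ε < ∑ i, g (b i),
            Real.exp (m * ε ^ 2 / 2) := by simp
      _ ≤ ∑ b ∈ Fintype.piFinset (fun _ : Fin m => P) with m * ε < ∑ i, g (b i),
            ∏ i, Real.exp (ε / 2 * g (b i)) := by
          refine sum_le_sum fun b hb => ?_
          rw [← Real.exp_sum, ← mul_sum, Real.exp_le_exp]
          have := (mem_filter.1 hb).2.le
          calc m * ε ^ 2 / 2 = ε / 2 * (m * ε) := by ring
            _ ≤ _ := by gcongr
      _ ≤ ∑ b ∈ Fintype.piFinset (fun _ : Fin m => P), ∏ i, Real.exp (ε / 2 * g (b i)) :=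
          sum_le_sum_of_subset_of_nonneg (filter_subset _ _) fun _ _ _ => by positivity
      _ = (∑ b ∈ P, Real.exp (ε / 2 * g b)) ^ m := by
          rw [← prod_univ_sum (fun _ => P) (fun _ b => Real.exp (ε / 2 * g b))]
          simp
      _ ≤ _ := by gcongr
  have h3 : (#P * Real.exp (ε ^ 2 / 4)) ^ m =
      Real.exp (-(m * ε ^ 2 / 4)) * (#P : ℝ) ^ m * Real.exp (m * ε ^ 2 / 2) := by
    rw [mul_pow, ← Real.exp_nat_mul, mul_right_comm, ← Real.exp_add, mul_comm]
    congr 2; ring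
  rw [h3] at h2
  exact le_of_mul_le_mul_right h2 (Real.exp_pos _)

/-- Two-sided version for the frequency of an event. -/
lemma card_abs_freq_gt_le {α : Type*} (P : Finset α) (hP : P.Nonempty) (q : α → Prop)
    [DecidablePred q] (m : ℕ) {ε : ℝ} (hε : 0 ≤ ε) (hε1 : ε ≤ 1) :
    (#{b ∈ Fintype.piFinset fun _ : Fin m => P |
        m * ε < |(#{i | q (b i)} : ℝ) - m * (#{b ∈ P | q b} / #P)|} : ℝ)
      ≤ 2 * Real.exp (-(m * ε ^ 2 / 4)) * (#P : ℝ) ^ m := by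
  have hP0 : (0 : ℝ) < #P := by exact_mod_cast hP.card_pos
  set f : ℝ := #{b ∈ P | q b} / #P with hf
  have hf0 : 0 ≤ f := by positivity
  have hf1 : f ≤ 1 := by
    rw [hf, div_le_one hP0]; exact_mod_cast card_filter_le _ _
  set g : α → ℝ := fun b => (if q b then 1 else 0) - f with hg
  have hgb : ∀ b ∈ P, |g b| ≤ 1 := by
    intro b _
    simp only [hg]
    split_ifs <;> rw [abs_le] <;> constructor <;> linarith
  have hg0 : ∑ b ∈ P, g b = 0 := by
    simp only [hg]
    rw [sum_sub_distrib, sum_boole, sum_const, nsmul_eq_mul, hf]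
    field_simp
    ring
  have hgs : ∀ b : Fin m → α, ∑ i, g (b i) = (#{i | q (b i)} : ℝ) - m * f := by
    intro b
    simp only [hg]
    rw [sum_sub_distrib, sum_boole, sum_const]
    simp
  have h1 := card_sum_gt_le P g hgb hg0 m hε hε1
  have h2 := card_sum_gt_le P (fun b => -g b) (fun b hb => by rw [abs_neg]; exact hgb b hb)
    (by rw [sum_neg_distrib, hg0, neg_zero]) m hε hε1
  have h3 : #{b ∈ Fintype.piFinset fun _ : Fin m => P |
      m * ε < |(#{i | q (b i)} : ℝ) - m * f|} ≤
      #{b ∈ Fintype.piFinset fun _ : Fin m => P | m * ε < ∑ i, g (b i)} +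
      #{b ∈ Fintype.piFinset fun _ : Fin m => P | m * ε < ∑ i, -g (b i)} := by
    classical
    refine (card_le_card ?_).trans (card_union_le _ _)
    rw [← filter_or]
    refine monotone_filter_right _ fun b _ hb => ?_
    rw [sum_neg_distrib, hgs]
    exact lt_abs.1 hb
  have h4 : (#{b ∈ Fintype.piFinset fun _ : Fin m => P |
      m * ε < |(#{i | q (b i)} : ℝ) - m * f|} : ℝ) ≤
      #{b ∈ Fintype.piFinset fun _ : Fin m => P | m * ε < ∑ i, g (b i)} +
      #{b ∈ Fintype.piFinset fun _ : Fin m => P | m * ε < ∑ i, -g (b i)} := by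
    exact_mod_cast h3
  linarith

/-- At least half of all tuples sample the density of `S` on translates of `P` well, for all but
few translates. -/
lemma half_le_card_good_tuples (P S U : Finset ℤ) (hP : P.Nonempty) (m : ℕ) {ε : ℝ} (hε : 0 ≤ ε)
    (hε1 : ε ≤ 1) :
    (#P : ℝ) ^ m ≤ 2 * #{b ∈ Fintype.piFinset fun _ : Fin m => P |
      (#{x ∈ U | m * ε < |(#{i | x - b i ∈ S} : ℝ) - m * (#{b ∈ P | x - b ∈ S} / #P)|} : ℝ)
        ≤ 4 * Real.exp (-(m * ε ^ 2 / 4)) * #U} := by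
  set δ := Real.exp (-(m * ε ^ 2 / 4)) with hδ
  have hδ0 : 0 < δ := Real.exp_pos _
  set T := Fintype.piFinset fun _ : Fin m => P with hT
  have hTc : (#T : ℝ) = (#P : ℝ) ^ m := by simp [hT]
  set r : (Fin m → ℤ) → ℤ → Prop := fun b x =>
    m * ε < |(#{i | x - b i ∈ S} : ℝ) - m * (#{b ∈ P | x - b ∈ S} / #P)| with hr
  have h1 : ∑ b ∈ T, (#{x ∈ U | r b x} : ℝ) ≤ 2 * δ * #U * #T := by
    have : ∑ b ∈ T, #{x ∈ U | r b x} = ∑ x ∈ U, #{b ∈ T | r b x} := by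
      simp only [card_filter]; exact sum_comm
    calc ∑ b ∈ T, (#{x ∈ U | r b x} : ℝ) = ∑ x ∈ U, (#{b ∈ T | r b x} : ℝ) := by
          exact_mod_cast this
      _ ≤ ∑ x ∈ U, 2 * δ * #T := by
          refine sum_le_sum fun x _ => ?_
          rw [hTc]
          exact card_abs_freq_gt_le P hP (fun b => x - b ∈ S) m hε hε1
      _ = _ := by rw [sum_const, nsmul_eq_mul]; ring
  have h2 : (#{b ∈ T | (#{x ∈ U | r b x} : ℝ) ≤ 4 * δ * #U} : ℝ) +
      #{b ∈ T | ¬ (#{x ∈ U | r b x} : ℝ) ≤ 4 * δ * #U} = #T := by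
    exact_mod_cast card_filter_add_card_filter_not (s := T) _
  have h3 : (#{b ∈ T | ¬ (#{x ∈ U | r b x} : ℝ) ≤ 4 * δ * #U} : ℝ) * (4 * δ * #U) ≤
      2 * δ * #U * #T := by
    refine le_trans ?_ h1
    rw [← nsmul_eq_mul, ← sum_const]
    refine (sum_le_sum fun b hb => (not_le.1 (mem_filter.1 hb).2).le).trans
      (sum_le_sum_of_subset_of_nonneg (filter_subset _ _) fun _ _ _ => Nat.cast_nonneg _)
  rw [← hTc]
  rcases U.eq_empty_or_nonempty with hU | hU
  · have : {b ∈ T | (#{x ∈ U | r b x} : ℝ) ≤ 4 * δ * #U} = T := by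
      refine filter_true_of_mem fun b _ => ?_
      rw [hU]; simp
    rw [this]
    have : (0 : ℝ) ≤ #T := Nat.cast_nonneg _
    linarith
  · have hU0 : (0 : ℝ) < #U := by exact_mod_cast hU.card_pos
    have h4 : (2 * (#{b ∈ T | ¬ (#{x ∈ U | r b x} : ℝ) ≤ 4 * δ * #U} : ℝ)) * (2 * δ * #U) ≤
        #T * (2 * δ * #U) := by linarith
    have := le_of_mul_le_mul_right h4 (by positivity)
    linarith

/-- A Croot--Sisask type statement: a large set of almost periods of `P - P`. -/
lemma exists_almost_periods (P : Finset ℤ) (hP : P.Nonempty) {κ : ℝ}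
    (hκ : (#(P - P + P) : ℝ) ≤ κ * #P) {k m : ℕ} (hk : 1 ≤ k)
    (hm : 8 * k * κ * Real.exp (-(m / (64 * k ^ 2))) < 1) :
    ∃ X ⊆ P, (#P : ℝ) * (#P : ℝ) ^ m ≤ 2 * (#(P + P) : ℝ) ^ m * #X ∧
      ∀ (I : Finset ℕ) (s s' : ℕ → ℤ), #I ≤ k → (∀ i ∈ I, s i ∈ X) → (∀ i ∈ I, s' i ∈ X) →
        ∑ i ∈ I, (s i - s' i) ∈ P - P + P - P := by
  have hP0 : (0 : ℝ) < #P := by exact_mod_cast hP.card_pos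
  have hk0 : (1 : ℝ) ≤ k := by exact_mod_cast hk
  set S := P - P with hS
  set U := S + P with hU
  set ε : ℝ := 1 / (4 * k) with hε
  have hε0 : 0 < ε := by positivity
  have hε1 : ε ≤ 1 := by rw [hε, div_le_one (by positivity)]; linarith
  have hm0 : 0 < m := by
    rcases Nat.eq_zero_or_pos m with h | h
    · exfalso
      have h2 : (1 : ℝ) * #P ≤ κ * #P := by
        refine le_trans ?_ hκ
        rw [one_mul]
        have : P ⊆ S + P := by
          obtain ⟨p, hp⟩ := hP
          refine subset_add_right P ?_
          rw [hS]; exact mem_sub.2 ⟨p, hp, p, hp, sub_self p⟩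
        exact_mod_cast card_le_card this
      have h3 := le_of_mul_le_mul_right h2 hP0
      rw [h] at hm
      simp at hm
      nlinarith
    · exact h
  have hmR : (0 : ℝ) < m := by exact_mod_cast hm0
  set δ := Real.exp (-(m * ε ^ 2 / 4)) with hδ
  have hδe : δ = Real.exp (-(m / (64 * k ^ 2))) := by
    rw [hδ, hε]; congr 1; field_simp; norm_num
  set f : ℤ → ℝ := fun x => #{b ∈ P | x - b ∈ S} / #P with hf
  set T := Fintype.piFinset fun _ : Fin m => P with hT
  set E : (Fin m → ℤ) → Finset ℤ := fun b =>
    {x ∈ U | m * ε < |(#{i | x - b i ∈ S} : ℝ) - m * f x|} with hE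
  set good := {b ∈ T | (#(E b) : ℝ) ≤ 4 * δ * #U} with hgood
  have hhalf : (#P : ℝ) ^ m ≤ 2 * #good := half_le_card_good_tuples P S U hP m hε0.le hε1
  have hEout : ∀ b ∈ good, ∀ x ∉ E b, |(#{i | x - b i ∈ S} : ℝ) - m * f x| ≤ m * ε := by
    intro b hb x hx
    by_cases hxU : x ∈ U
    · by_contra hc
      exact hx (mem_filter.2 ⟨hxU, not_le.1 hc⟩)
    · have h1 : #{i | x - b i ∈ S} = 0 := by
        rw [card_eq_zero, filter_eq_empty_iff]
        intro i _ hi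
        refine hxU (mem_add.2 ⟨_, hi, b i, ?_, by ring⟩)
        exact Fintype.mem_piFinset.1 (mem_filter.1 hb).1 i
      have h2 : f x = 0 := by
        simp only [hf]
        rw [card_eq_zero.2 (filter_eq_empty_iff.2 fun b hb hi =>
          hxU (mem_add.2 ⟨_, hi, b, hb, by ring⟩))]
        simp
      rw [h1, h2]; simp; positivity
  obtain ⟨c, -, hc⟩ : ∃ c ∈ Fintype.piFinset (fun _ : Fin m => P + P),
      #good * #P ≤ #(Fintype.piFinset (fun _ : Fin m => P + P)) *
        #{p ∈ good ×ˢ P | (fun i => p.1 i + p.2) = c} := by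
    have hne : (Fintype.piFinset (fun _ : Fin m => P + P)).Nonempty :=
      Fintype.piFinset_nonempty.2 fun _ => hP.add hP
    have hsum : ∑ c ∈ Fintype.piFinset (fun _ : Fin m => P + P),
        #{p ∈ good ×ˢ P | (fun i => p.1 i + p.2) = c} = #good * #P := by
      rw [← card_product]
      refine (card_eq_sum_card_fiberwise ?_).symm
      rintro ⟨b, s⟩ hp
      simp only [coe_product, Set.mem_prod, mem_coe] at hp
      simp only [mem_coe, Fintype.mem_piFinset]
      exact fun i => add_mem_add (Fintype.mem_piFinset.1 (mem_filter.1 hp.1).1 i) hp.2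
    by_contra! hcon
    have := sum_lt_sum_of_nonempty hne hcon
    rw [← mul_sum, hsum, sum_const, smul_eq_mul] at this
    exact lt_irrefl _ this
  set X := {s ∈ P | (fun i => c i - s) ∈ good} with hX
  have hXc : #{p ∈ good ×ˢ P | (fun i => p.1 i + p.2) = c} ≤ #X := by
    refine card_le_card_of_injOn (fun p => p.2) ?_ ?_
    · rintro ⟨b, s⟩ hp
      simp only [mem_coe, mem_filter, mem_product] at hp
      simp only [hX, mem_coe, mem_filter]
      refine ⟨hp.1.2, ?_⟩
      have : (fun i => c i - s) = b := by
        funext i; rw [← hp.2]; simp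
      rw [this]; exact hp.1.1
    · rintro ⟨b, s⟩ hp ⟨b', s'⟩ hp' he
      simp only [mem_coe, mem_filter, mem_product] at hp hp'
      simp only at he
      subst he
      have : b = b' := by
        funext i
        have h1 := congrFun hp.2 i
        have h2 := congrFun hp'.2 i
        linarith
      rw [this]
  refine ⟨X, filter_subset _ _, ?_, ?_⟩
  · have h1 : (#good * #P : ℝ) ≤ (#(P + P) : ℝ) ^ m * #X := by
      have h2 := hc.trans (Nat.mul_le_mul_left _ hXc)
      rw [Fintype.card_piFinset_const] at h2
      exact_mod_cast h2
    nlinarith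
  · have hstep : ∀ s ∈ X, ∀ s' ∈ X, ∀ x, x ∉ E (fun i => c i - s) →
        x + (s - s') ∉ E (fun i => c i - s') → |f x - f (x + (s - s'))| ≤ 2 * ε := by
      intro s hs s' hs' x h1 h2
      have h3 := hEout _ (mem_filter.1 hs).2 x h1
      have h4 := hEout _ (mem_filter.1 hs').2 _ h2
      have e : ∀ i, x + (s - s') - (c i - s') = x - (c i - s) := fun i => by ring
      simp only [e] at h4
      rw [abs_le] at h3 h4
      have h5 : |m * (f x - f (x + (s - s')))| ≤ m * (2 * ε) := by
        rw [abs_le]; constructor <;> linarith [h3.1, h3.2, h4.1, h4.2]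
      rw [abs_mul, abs_of_pos hmR] at h5
      exact le_of_mul_le_mul_left h5 hmR
    have hf1 : ∀ x ∈ P, f x = 1 := by
      intro x hx
      simp only [hf]
      rw [filter_true_of_mem fun b hb => sub_mem_sub hx hb, div_self hP0.ne']
    set β := 4 * δ * (#U : ℝ) with hβ
    have hind : ∀ (I : Finset ℕ) (s s' : ℕ → ℤ), (∀ i ∈ I, s i ∈ X) → (∀ i ∈ I, s' i ∈ X) →
        ∃ W : Finset ℤ, (#W : ℝ) ≤ 2 * β * #I ∧ ∀ x ∈ P, x ∉ W →
          |1 - f (x + ∑ i ∈ I, (s i - s' i))| ≤ 2 * ε * #I := by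
      intro I s s'
      induction I using Finset.induction_on with
      | empty =>
        intro _ _
        refine ⟨∅, by simp, fun x hx _ => ?_⟩
        rw [sum_empty, add_zero, hf1 x hx]; simp
      | insert j I hj ih =>
        intro hs hs'
        obtain ⟨W, hW, hWx⟩ := ih (fun i hi => hs i (mem_insert_of_mem hi))
          (fun i hi => hs' i (mem_insert_of_mem hi))
        have hsj := hs j (mem_insert_self _ _)
        have hsj' := hs' j (mem_insert_self _ _)
        set σ := ∑ i ∈ I, (s i - s' i) with hσ
        set E1 := (E (fun i => c i - s j)).image (fun y => y - σ) with hE1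
        set E2 := (E (fun i => c i - s' j)).image (fun y => y - (σ + (s j - s' j))) with hE2
        refine ⟨W ∪ E1 ∪ E2, ?_, ?_⟩
        · have h1 : (#(W ∪ E1 ∪ E2) : ℝ) ≤ #W + #(E fun i => c i - s j) +
              #(E fun i => c i - s' j) := by
            exact_mod_cast (card_union_le _ _).trans
              (add_le_add ((card_union_le _ _).trans (add_le_add le_rfl card_image_le))
                card_image_le)
          have h2 : (#(E fun i => c i - s j) : ℝ) ≤ β := (mem_filter.1 (mem_filter.1 hsj).2).2
          have h3 : (#(E fun i => c i - s' j) : ℝ) ≤ β := (mem_filter.1 (mem_filter.1 hsj').2).2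
          rw [card_insert_of_notMem hj]
          push_cast
          linarith
        · intro x hx hxW
          simp only [mem_union, not_or] at hxW
          have h1 := hWx x hx hxW.1.1
          have h2 := hstep (s j) hsj (s' j) hsj' (x + σ)
            (fun h => hxW.1.2 (mem_image.2 ⟨_, h, by ring⟩))
            (fun h => hxW.2 (mem_image.2 ⟨_, h, by ring⟩))
          rw [sum_insert hj, card_insert_of_notMem hj]
          have e : x + (s j - s' j + σ) = x + σ + (s j - s' j) := by ring
          rw [e]
          push_cast
          rw [abs_le] at h1 h2 ⊢
          constructor <;> linarith [h1.1, h1.2, h2.1, h2.2]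
    intro I s s' hI hs hs'
    obtain ⟨W, hW, hWx⟩ := hind I s s' hs hs'
    have hIk : (#I : ℝ) ≤ k := by exact_mod_cast hI
    have hWP : (#W : ℝ) < #P := by
      calc (#W : ℝ) ≤ 2 * β * #I := hW
        _ ≤ 2 * β * k := by gcongr
        _ = 8 * k * δ * #U := by rw [hβ]; ring
        _ ≤ 8 * k * δ * (κ * #P) := by gcongr
        _ = (8 * k * κ * δ) * #P := by ring
        _ < 1 * #P := by rw [hδe]; gcongr
        _ = _ := one_mul _
    obtain ⟨x, hx, hxW⟩ := exists_mem_notMem_of_card_lt_card (s := W) (t := P) (by exact_mod_cast hWP)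
    have h1 := hWx x hx hxW
    have h2 : 2 * ε * #I ≤ 1 / 2 := by
      calc 2 * ε * #I ≤ 2 * ε * k := by gcongr
        _ = 1 / 2 := by rw [hε]; field_simp; norm_num
    have h3 : 0 < f (x + ∑ i ∈ I, (s i - s' i)) := by linarith [(abs_le.1 h1).2]
    have h4 : ({b ∈ P | x + ∑ i ∈ I, (s i - s' i) - b ∈ S}).Nonempty := by
      rw [nonempty_iff_ne_empty]
      intro h
      simp only [hf] at h3
      rw [h] at h3
      simp at h3
    obtain ⟨b, hb⟩ := h4
    rw [mem_filter] at hb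
    refine mem_sub.2 ⟨x + ∑ i ∈ I, (s i - s' i), mem_add.2 ⟨_, hb.2, b, hb.1, by ring⟩, x, hx, by ring⟩

lemma card_nsmul_sub_nsmul_le (P : Finset ℤ) (hP : P.Nonempty) {K : ℝ}
    (hK : (#(P - P) : ℝ) ≤ K * #P) (a b : ℕ) :
    (#(a • P - b • P) : ℝ) ≤ K ^ (a + b) * #P := by
  have hP0 : (0 : ℝ) < #P := by exact_mod_cast hP.card_pos
  have h1 := pluennecke_ruzsa_inequality_nsmul_sub_nsmul_sub hP P a b
  have h2 : (#(a • P - b • P) : ℝ) ≤ ((#(P - P) : ℝ) / #P) ^ (a + b) * #P := by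
    have h3 := (NNRat.cast_le (K := ℝ)).2 h1
    push_cast at h3
    exact h3
  refine h2.trans ?_
  gcongr
  rwa [div_le_iff₀ hP0]

lemma card_image_two_pow_mul_sub_le (P : Finset ℤ) (hP : P.Nonempty) {K : ℝ}
    (hK : (#(P - P) : ℝ) ≤ K * #P) (i : ℕ) :
    (#(P.image (fun x => 2 ^ i * x) - P) : ℝ) ≤ K ^ (3 * i + 1) * #P := by
  have hP0 : (0 : ℝ) < #P := by exact_mod_cast hP.card_pos
  have hcard : ∀ j, #(P.image (fun x => (2 : ℤ) ^ j * x)) = #P := fun j =>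
    card_image_of_injective _ (mul_right_injective₀ (by positivity))
  induction i with
  | zero => simpa using hK
  | succ i ih =>
    have h1 := ruzsa_triangle_inequality_sub_sub_sub (P.image (fun x => (2 : ℤ) ^ (i + 1) * x))
      (P.image (fun x => (2 : ℤ) ^ i * x)) P
    rw [hcard, ← neg_sub (P.image (fun x => (2 : ℤ) ^ i * x)) P, card_neg] at h1
    have h2 : #(P.image (fun x => (2 : ℤ) ^ (i + 1) * x) - P.image (fun x => (2 : ℤ) ^ i * x))
        ≤ #(2 • P - 1 • P) := by
      refine le_trans (card_le_card ?_)
        (card_image_le (s := 2 • P - 1 • P) (f := fun x => (2 : ℤ) ^ i * x))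
      intro z hz
      obtain ⟨x, hx, y, hy, rfl⟩ := mem_sub.1 hz
      obtain ⟨p, hp, rfl⟩ := mem_image.1 hx
      obtain ⟨q, hq, rfl⟩ := mem_image.1 hy
      refine mem_image.2 ⟨p + p - q, ?_, by ring⟩
      rw [two_nsmul, one_nsmul]
      exact sub_mem_sub (add_mem_add hp hp) hq
    have h3 := card_nsmul_sub_nsmul_le P hP hK 2 1
    have h4 : (#(P.image (fun x => (2 : ℤ) ^ (i + 1) * x) - P) : ℝ) * #P ≤
        K ^ (3 * (i + 1) + 1) * #P * #P := by
      calc _ ≤ (#(P.image (fun x => (2 : ℤ) ^ (i + 1) * x) - P.image (fun x => (2 : ℤ) ^ i * x)) : ℝ)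
            * #(P.image (fun x => (2 : ℤ) ^ i * x) - P) := by exact_mod_cast h1
        _ ≤ (K ^ (2 + 1) * #P) * (K ^ (3 * i + 1) * #P) := by
            refine mul_le_mul (le_trans (by exact_mod_cast h2) h3) ih (by positivity)
              (le_trans (by positivity) h3)
        _ = _ := by ring
    exact le_of_mul_le_mul_right h4 hP0

/-- Many elements of `P` have their first dyadic dilates in prescribed translates of `X`. -/
lemma exists_dyadic_fiber (P X : Finset ℤ) (hP : P.Nonempty) (hXP : X ⊆ P) {K : ℝ}
    (hK1 : 1 ≤ K) (hK : (#(P - P) : ℝ) ≤ K * #P) (L : ℕ) :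
    ∃ H ⊆ P, ∃ v : ℕ → ℤ, (∀ h ∈ H, ∀ i < L, 2 ^ i * h - v i ∈ X) ∧
      (#P : ℝ) * (#X : ℝ) ^ L ≤ (K ^ (3 * L + 1) * #P) ^ L * #H := by
  set T : Finset (Fin L → ℤ) :=
    Fintype.piFinset fun i : Fin L => P.image (fun x => (2 : ℤ) ^ (i : ℕ) * x) - P with hT
  set Q : Finset (ℤ × (Fin L → ℤ)) := P ×ˢ Fintype.piFinset fun _ : Fin L => X with hQ
  set φ : ℤ × (Fin L → ℤ) → Fin L → ℤ := fun p i => 2 ^ (i : ℕ) * p.1 - p.2 i with hφ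
  have hTne : T.Nonempty := Fintype.piFinset_nonempty.2 fun i => (hP.image _).sub hP
  obtain ⟨v, -, hv⟩ : ∃ v ∈ T, #Q ≤ #T * #{p ∈ Q | φ p = v} := by
    have hsum : ∑ v ∈ T, #{p ∈ Q | φ p = v} = #Q := by
      refine (card_eq_sum_card_fiberwise ?_).symm
      rintro ⟨h, s⟩ hp
      simp only [hQ, coe_product, Set.mem_prod, mem_coe, Fintype.mem_piFinset] at hp
      simp only [hT, mem_coe, Fintype.mem_piFinset]
      exact fun i => sub_mem_sub (mem_image_of_mem _ hp.1) (hXP (hp.2 i))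
    by_contra! hcon
    have := sum_lt_sum_of_nonempty hTne hcon
    rw [← mul_sum, hsum, sum_const, smul_eq_mul] at this
    exact lt_irrefl _ this
  set H := {h ∈ P | ∀ i : Fin L, 2 ^ (i : ℕ) * h - v i ∈ X} with hH
  have hle : #{p ∈ Q | φ p = v} ≤ #H := by
    refine card_le_card_of_injOn (fun p => p.1) ?_ ?_
    · rintro ⟨h, s⟩ hp
      simp only [hQ, mem_coe, mem_filter, mem_product, Fintype.mem_piFinset] at hp
      simp only [hH, mem_coe, mem_filter]
      refine ⟨hp.1.1, fun i => ?_⟩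
      have h1 := hp.1.2 i
      rw [← hp.2]
      simpa [hφ] using h1
    · rintro ⟨h, s⟩ hp ⟨h', s'⟩ hp' he
      simp only [mem_coe, mem_filter] at hp hp'
      change h = h' at he
      subst he
      have : s = s' := by
        funext i
        have h1 := congrFun hp.2 i
        have h2 := congrFun hp'.2 i
        simp only [hφ] at h1 h2
        linarith
      rw [this]
  refine ⟨H, filter_subset _ _, fun i => if hi : i < L then v ⟨i, hi⟩ else 0, ?_, ?_⟩
  · intro h hh i hi
    simp only [dif_pos hi]
    exact (mem_filter.1 hh).2 ⟨i, hi⟩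
  · have h1 : (#Q : ℝ) ≤ #T * #H := by exact_mod_cast hv.trans (Nat.mul_le_mul_left _ hle)
    have h2 : (#Q : ℝ) = #P * (#X : ℝ) ^ L := by
      rw [hQ, card_product, Fintype.card_piFinset_const]; push_cast; rfl
    have h3 : (#T : ℝ) ≤ (K ^ (3 * L + 1) * #P) ^ L := by
      rw [hT, Fintype.card_piFinset]
      push_cast
      calc ∏ i : Fin L, (#(P.image (fun x => (2 : ℤ) ^ (i : ℕ) * x) - P) : ℝ)
          ≤ ∏ _i : Fin L, K ^ (3 * L + 1) * (#P : ℝ) := by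
            refine prod_le_prod (fun _ _ => by positivity) fun i _ => ?_
            refine (card_image_two_pow_mul_sub_le P hP hK i).trans ?_
            gcongr
            exact i.2.le
        _ = _ := by simp
    rw [← h2]
    exact h1.trans (by gcongr)

/-- A set with small difference set has a large subset whose dilates by all integers of bounded
size lie in translates of a fixed bounded sumset. -/
lemma exists_subset_dilates (P : Finset ℤ) (hP : P.Nonempty) {K : ℝ} (hK1 : 1 ≤ K)
    (hK : (#(P - P) : ℝ) ≤ K * #P) {L m : ℕ} (hL : 1 ≤ L)
    (hm : 8 * L * K ^ 3 * Real.exp (-(m / (64 * L ^ 2))) < 1) :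
    ∃ H ⊆ P, (#P : ℝ) ≤ (2 * K ^ (2 * m + 3 * L + 1)) ^ L * #H ∧
      ∀ w : ℕ, w < 2 ^ L → ∃ u : ℤ, ∀ h ∈ H, w * h - u ∈ P - P + P - P := by
  have hP0 : (0 : ℝ) < #P := by exact_mod_cast hP.card_pos
  have h3 : (#(P - P + P) : ℝ) ≤ K ^ 3 * #P := by
    have := card_nsmul_sub_nsmul_le P hP hK 2 1
    rwa [two_nsmul, one_nsmul, ← sub_add_eq_add_sub] at this
  have h2 : (#(P + P) : ℝ) ≤ K ^ 2 * #P := by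
    have := card_nsmul_sub_nsmul_le P hP hK 2 0
    rwa [two_nsmul, zero_nsmul, sub_zero] at this
  obtain ⟨X, hXP, hX, hXs⟩ := exists_almost_periods P hP h3 hL hm
  have hX1 : (#P : ℝ) ≤ 2 * K ^ (2 * m) * #X := by
    have : (#P : ℝ) * (#P : ℝ) ^ m ≤ 2 * K ^ (2 * m) * #X * (#P : ℝ) ^ m := by
      calc _ ≤ _ := hX
        _ ≤ 2 * (K ^ 2 * #P) ^ m * #X := by gcongr
        _ = _ := by rw [mul_pow, ← pow_mul]; ring
    exact le_of_mul_le_mul_right this (by positivity)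
  have hX0 : X.Nonempty := by
    rw [nonempty_iff_ne_empty]
    rintro rfl
    simp at hX1
    rw [hX1] at hP; exact not_nonempty_empty hP
  obtain ⟨s₀, hs₀⟩ := hX0
  obtain ⟨H, hHP, v, hv, hHc⟩ := exists_dyadic_fiber P X hP hXP hK1 hK L
  refine ⟨H, hHP, ?_, ?_⟩
  · have h4 : (#P : ℝ) * (#P : ℝ) ^ L ≤ (2 * K ^ (2 * m + 3 * L + 1)) ^ L * #H * (#P : ℝ) ^ L := by
      calc (#P : ℝ) * (#P : ℝ) ^ L ≤ #P * (2 * K ^ (2 * m) * #X) ^ L := by gcongr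
        _ = (2 * K ^ (2 * m)) ^ L * (#P * (#X : ℝ) ^ L) := by ring
        _ ≤ (2 * K ^ (2 * m)) ^ L * ((K ^ (3 * L + 1) * #P) ^ L * #H) := by gcongr
        _ = _ := by ring
    exact le_of_mul_le_mul_right h4 (by positivity)
  · intro w hw
    set I := w.bitIndices.toFinset with hI
    have hIL : ∀ i ∈ I, i < L := by
      intro i hi
      have := Nat.two_pow_le_of_mem_bitIndices (List.mem_toFinset.1 hi)
      exact (Nat.pow_lt_pow_iff_right (by norm_num : 1 < 2)).1 (this.trans_lt hw)
    have hIc : #I ≤ L := by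
      have : I ⊆ range L := fun i hi => mem_range.2 (hIL i hi)
      simpa using card_le_card this
    have hwI : (w : ℤ) = ∑ i ∈ I, 2 ^ i := by
      exact_mod_cast (Finset.sum_toFinset_bitIndices_two_pow w).symm
    refine ⟨∑ i ∈ I, (v i + s₀), fun h hh => ?_⟩
    have := hXs I (fun i => 2 ^ i * h - v i) (fun _ => s₀) hIc
      (fun i hi => hv h hh i (hIL i hi)) (fun _ _ => hs₀)
    convert this using 1
    rw [hwI, sum_mul, ← sum_sub_distrib]
    exact sum_congr rfl fun i _ => by ring

lemma mul_log_add_mul_log_le {a b x : ℝ} (ha : 0 < a) (hb : 0 < b) (hxa : x ≤ a) (hxb : x ≤ b) :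
    a * Real.log a + b * Real.log b + x * Real.log 2 ≤ (a + b) * Real.log (a + b) := by
  have key : ∀ {a b : ℝ}, 0 < a → a ≤ b → x ≤ a →
      a * Real.log a + b * Real.log b + x * Real.log 2 ≤ (a + b) * Real.log (a + b) := by
    intro a b ha hab hx
    have h1 : Real.log 2 + Real.log a ≤ Real.log (a + b) := by
      rw [← Real.log_mul (by norm_num) ha.ne']
      exact Real.log_le_log (by positivity) (by linarith)
    have h2 : Real.log b ≤ Real.log (a + b) :=
      Real.log_le_log (by linarith) (by linarith)
    have h3 := Real.log_pos (by norm_num : (1 : ℝ) < 2)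
    have hb : 0 < b := by linarith
    have h4 := mul_le_mul_of_nonneg_left h1 ha.le
    have h5 := mul_le_mul_of_nonneg_left h2 hb.le
    have h6 := mul_le_mul_of_nonneg_right hx h3.le
    linarith
  rcases le_total a b with h | h
  · exact key ha h hxa
  · have := key hb h hxb
    rw [add_comm b a] at this
    linarith

/-- The graph on a finite set of positive integers joining `u` to `u * t` for `t` in a set of
primes is sparse. -/
lemma card_prime_edges_le (S : Finset ℕ) (hS : ∀ t ∈ S, t.Prime) (V : Finset ℕ)
    (hV : ∀ u ∈ V, 0 < u) :
    (#{e ∈ V ×ˢ S | e.1 * e.2 ∈ V} : ℝ) * Real.log 2 ≤ #V * Real.log #V := by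
  induction V using Finset.strongInduction with
  | H V ih =>
    rcases ({e ∈ V ×ˢ S | e.1 * e.2 ∈ V}).eq_empty_or_nonempty with h0 | ⟨⟨u, q⟩, huq⟩
    · rw [h0]
      simp only [card_empty, Nat.cast_zero, zero_mul]
      exact mul_nonneg (Nat.cast_nonneg _) (Real.log_natCast_nonneg _)
    · simp only [mem_filter, mem_product] at huq
      have hq := hS q huq.1.2
      have hu := hV u huq.1.1
      obtain ⟨c, hc1, hc2⟩ : ∃ c, ¬ q ^ c ∣ u ∧ q ^ c ∣ u * q := by
        refine ⟨padicValNat q u + 1, ?_, ?_⟩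
        · have := Fact.mk hq
          exact pow_succ_padicValNat_not_dvd hu.ne'
        · rw [pow_succ]
          exact Nat.mul_dvd_mul_right pow_padicValNat_dvd _
      set V1 := {x ∈ V | q ^ c ∣ x} with hV1
      set V0 := {x ∈ V | ¬ q ^ c ∣ x} with hV0
      have hcard : #V1 + #V0 = #V := card_filter_add_card_filter_not _
      have m0 : u ∈ V0 := mem_filter.2 ⟨huq.1.1, hc1⟩
      have m1 : u * q ∈ V1 := mem_filter.2 ⟨huq.2, hc2⟩
      have s0 : V0 ⊂ V := filter_ssubset.2 ⟨u * q, huq.2, fun h => h hc2⟩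
      have s1 : V1 ⊂ V := filter_ssubset.2 ⟨u, huq.1.1, hc1⟩
      have i0 := ih V0 s0 fun x hx => hV x (s0.1 hx)
      have i1 := ih V1 s1 fun x hx => hV x (s1.1 hx)
      set M := {x ∈ V0 | x * q ∈ V1} with hM
      have hM0 : #M ≤ #V0 := card_filter_le _ _
      have hM1 : #M ≤ #V1 := by
        refine card_le_card_of_injOn (fun x => x * q) (fun x hx => (mem_filter.1 hx).2) ?_
        intro x _ y _ hxy
        exact Nat.eq_of_mul_eq_mul_right hq.pos hxy
      have hE : #{e ∈ V ×ˢ S | e.1 * e.2 ∈ V} ≤ #{e ∈ V1 ×ˢ S | e.1 * e.2 ∈ V1} +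
          #{e ∈ V0 ×ˢ S | e.1 * e.2 ∈ V0} + #M := by
        have hsub : {e ∈ V ×ˢ S | e.1 * e.2 ∈ V} ⊆ {e ∈ V1 ×ˢ S | e.1 * e.2 ∈ V1} ∪
            {e ∈ V0 ×ˢ S | e.1 * e.2 ∈ V0} ∪ M.image (fun x => (x, q)) := by
          rintro ⟨x, t⟩ he
          simp only [mem_filter, mem_product] at he
          obtain ⟨⟨hx, ht⟩, hxt⟩ := he
          simp only [mem_union, mem_filter, mem_product, mem_image, hV1, hV0, hM, hx, ht, hxt,
            true_and, and_true]
          by_cases h1 : q ^ c ∣ x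
          · exact Or.inl (Or.inl ⟨h1, h1.mul_right t⟩)
          · by_cases h2 : q ^ c ∣ x * t
            · have htq : t = q := by
                by_contra hne
                refine h1 (Nat.Coprime.dvd_of_dvd_mul_right ?_ h2)
                exact Nat.Coprime.pow_left _
                  ((Nat.coprime_primes hq (hS t ht)).2 fun h => hne h.symm)
              subst htq
              exact Or.inr ⟨x, ⟨⟨hx, h1⟩, hxt, h2⟩, rfl⟩
            · exact Or.inl (Or.inr ⟨h1, h2⟩)
        refine (card_le_card hsub).trans ((card_union_le _ _).trans ?_)
        exact add_le_add (card_union_le _ _) card_image_le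
      have hER : (#{e ∈ V ×ˢ S | e.1 * e.2 ∈ V} : ℝ) ≤ #{e ∈ V1 ×ˢ S | e.1 * e.2 ∈ V1} +
          #{e ∈ V0 ×ˢ S | e.1 * e.2 ∈ V0} + #M := by exact_mod_cast hE
      have hl2 := Real.log_pos (by norm_num : (1 : ℝ) < 2)
      have hfin := mul_log_add_mul_log_le (a := #V1) (b := #V0) (x := #M)
        (by exact_mod_cast card_pos.2 ⟨_, m1⟩) (by exact_mod_cast card_pos.2 ⟨_, m0⟩)
        (by exact_mod_cast hM1) (by exact_mod_cast hM0)
      have hcR : (#V1 : ℝ) + #V0 = #V := by exact_mod_cast hcard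
      rw [hcR] at hfin
      have := mul_le_mul_of_nonneg_right hER hl2.le
      linarith

/-- Few pairs `(p, t)` have a ratio `p / t` with many representations. -/
lemma card_multiple_ratios_le (S R : Finset ℕ) (hS : ∀ t ∈ S, t.Prime) (hR : ∀ p ∈ R, 0 < p)
    {Λ : ℝ} (hΛ0 : 0 < Λ) (hΛ : Real.log (#R * (1 + #S)) ≤ Λ * Real.log 2) {r : ℕ}
    (hr : 2 * Λ ≤ r) :
    (#{e ∈ R ×ˢ S | r ≤ #{t' ∈ S | ∃ p' ∈ R, e.1 * t' = p' * e.2}} : ℝ) ≤ 2 * #R * Λ := by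
  set bad := {e ∈ R ×ˢ S | r ≤ #{t' ∈ S | ∃ p' ∈ R, e.1 * t' = p' * e.2}} with hbad
  set c : ℕ → ℕ := fun t => ∏ x ∈ S.erase t, x with hc
  set Q := ∏ x ∈ S, x with hQ
  have hcQ : ∀ t ∈ S, c t * t = Q := fun t ht => prod_erase_mul S (fun x => x) ht
  have hQ0 : 0 < Q := prod_pos fun t ht => (hS t ht).pos
  have hc0 : ∀ t, 0 < c t := fun t => prod_pos fun x hx => (hS x (mem_of_mem_erase hx)).pos
  set W := bad.image fun e => e.1 * c e.2 with hW
  set V := W ∪ R.image (fun p => p * Q) with hV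
  have hl2 := Real.log_pos (by norm_num : (1 : ℝ) < 2)
  have hVpos : ∀ u ∈ V, 0 < u := by
    intro u hu
    rcases mem_union.1 hu with h | h
    · obtain ⟨e, he, rfl⟩ := mem_image.1 h
      exact Nat.mul_pos (hR _ (mem_product.1 (mem_filter.1 he).1).1) (hc0 _)
    · obtain ⟨p, hp, rfl⟩ := mem_image.1 h
      exact Nat.mul_pos (hR _ hp) hQ0
  have hedge := card_prime_edges_le S hS V hVpos
  have hbadE : #bad ≤ #{e ∈ V ×ˢ S | e.1 * e.2 ∈ V} := by
    refine card_le_card_of_injOn (fun e => (e.1 * c e.2, e.2)) ?_ ?_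
    · rintro ⟨p, t⟩ he
      have h1 := mem_product.1 (mem_filter.1 he).1
      simp only [mem_coe, mem_filter, mem_product]
      refine ⟨⟨mem_union_left _ (mem_image_of_mem _ he), h1.2⟩, mem_union_right _ ?_⟩
      refine mem_image.2 ⟨p, h1.1, ?_⟩
      rw [mul_assoc, hcQ t h1.2]
    · rintro ⟨p, t⟩ _ ⟨p', t'⟩ _ h
      simp only [Prod.mk.injEq] at h
      obtain ⟨h1, rfl⟩ := h
      rw [Nat.eq_of_mul_eq_mul_right (hc0 t) h1]
  have hWE : r * #W ≤ #{e ∈ V ×ˢ S | e.1 * e.2 ∈ V} := by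
    rw [card_filter, sum_product]
    calc r * #W = ∑ x ∈ W, r := by rw [sum_const, smul_eq_mul, mul_comm]
      _ ≤ ∑ x ∈ W, ∑ t ∈ S, if x * t ∈ V then 1 else 0 := by
          refine sum_le_sum fun x hx => ?_
          rw [← card_filter]
          obtain ⟨⟨p, t⟩, he, rfl⟩ := mem_image.1 hx
          refine (mem_filter.1 he).2.trans (card_le_card ?_)
          refine monotone_filter_right _ fun t' ht' hp => ?_
          obtain ⟨p', hp', h⟩ := hp
          refine mem_union_right _ (mem_image.2 ⟨p', hp', ?_⟩)
          have ht := (mem_product.1 (mem_filter.1 he).1).2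
          simp only at h ht ⊢
          rw [← hcQ t ht]
          calc p' * (c t * t) = p' * t * c t := by ring
            _ = p * t' * c t := by rw [h]
            _ = _ := by ring
      _ ≤ _ := sum_le_sum_of_subset subset_union_left
  set E : ℝ := (#{e ∈ V ×ˢ S | e.1 * e.2 ∈ V} : ℝ) with hE
  have hWRS : (#W : ℝ) ≤ #R * #S := by
    have := (card_image_le (s := bad) (f := fun e => e.1 * c e.2)).trans (card_filter_le _ _)
    rw [card_product] at this
    exact_mod_cast this
  have hVc : (#V : ℝ) ≤ #R + #W := by
    have := (card_union_le W (R.image (fun p => p * Q))).trans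
      (Nat.add_le_add_left card_image_le _)
    have h2 : (#V : ℝ) ≤ #W + #R := by exact_mod_cast this
    linarith
  have hEle : E ≤ (#R + #W) * Λ := by
    have hlog : Real.log #V ≤ Λ * Real.log 2 := by
      rcases Nat.eq_zero_or_pos #V with h | h
      · rw [h]; simp; positivity
      · refine (Real.log_le_log (by exact_mod_cast h) ?_).trans hΛ
        linarith [show (#R : ℝ) * (1 + #S) = #R + #R * #S by ring]
    have : E * Real.log 2 ≤ (#R + #W) * Λ * Real.log 2 := by
      calc _ ≤ _ := hedge
        _ ≤ (#R + #W) * (Λ * Real.log 2) := by gcongr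
        _ = _ := by ring
    exact le_of_mul_le_mul_right this hl2
  have h1 : (#bad : ℝ) ≤ E := by rw [hE]; exact_mod_cast hbadE
  have h2 : (r : ℝ) * #W ≤ E := by rw [hE]; exact_mod_cast hWE
  have h3 : (2 * Λ) * #W ≤ r * #W := by gcongr
  have h4 : Λ * #W ≤ Λ * #R := by linarith
  linarith

lemma le_sum_pow_four {ι : Type*} (Y : Finset ι) (w : ι → ℝ) {a N : ℝ}
    (ha0 : 0 ≤ a) (ha : a ≤ ∑ y ∈ Y, w y) (hN : (#Y : ℝ) ≤ N) :
    a ^ 4 ≤ N ^ 3 * ∑ y ∈ Y, w y ^ 4 := by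
  have h0 : 0 ≤ ∑ y ∈ Y, w y ^ 2 := sum_nonneg fun _ _ => by positivity
  have h1 : (∑ y ∈ Y, w y) ^ 2 ≤ #Y * ∑ y ∈ Y, w y ^ 2 := sq_sum_le_card_mul_sum_sq
  have h2 : (∑ y ∈ Y, w y ^ 2) ^ 2 ≤ #Y * ∑ y ∈ Y, (w y ^ 2) ^ 2 := sq_sum_le_card_mul_sum_sq
  have h3 : ∑ y ∈ Y, (w y ^ 2) ^ 2 = ∑ y ∈ Y, w y ^ 4 := sum_congr rfl fun _ _ => by ring
  rw [h3] at h2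
  have h4 : 0 ≤ ∑ y ∈ Y, w y ^ 4 := sum_nonneg fun _ _ => by positivity
  calc a ^ 4 ≤ (∑ y ∈ Y, w y) ^ 4 := by gcongr
    _ = ((∑ y ∈ Y, w y) ^ 2) ^ 2 := by ring
    _ ≤ (#Y * ∑ y ∈ Y, w y ^ 2) ^ 2 := by gcongr
    _ = (#Y : ℝ) ^ 2 * (∑ y ∈ Y, w y ^ 2) ^ 2 := by ring
    _ ≤ (#Y : ℝ) ^ 2 * (#Y * ∑ y ∈ Y, w y ^ 4) := by gcongr
    _ = (#Y : ℝ) ^ 3 * ∑ y ∈ Y, w y ^ 4 := by ring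
    _ ≤ _ := by gcongr

/-- Points `(t, y)` for which `y + t ^ 2 * z` is a good square for four values of `z`. -/
lemma card_four_squares_le {C : ℕ} (hU : U2 C) (S R : Finset ℕ) (hS : ∀ t ∈ S, t.Prime) (r : ℕ)
    (I : Finset (Σ _ : ℕ, ℤ)) (hI : ∀ i ∈ I, i.1 ∈ S) (Z : Finset ℤ) (hZ : #Z = 4)
    (h : ∀ i ∈ I, ∀ z ∈ Z, ∃ p ∈ R, #{t' ∈ S | ∃ p' ∈ R, p * t' = p' * i.1} ≤ r ∧
      i.2 + (i.1 : ℤ) ^ 2 * z = (p : ℤ) ^ 2) : #I ≤ C * r := by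
  obtain ⟨z₀, hz₀⟩ : Z.Nonempty := by rw [← card_pos, hZ]; norm_num
  choose! p hpR hpr hp using fun i hi => h i hi z₀ hz₀
  set ρ : (Σ _ : ℕ, ℤ) → ℚ := fun i => (p i : ℚ) / i.1 with hρ
  have ht0 : ∀ i ∈ I, (i.1 : ℚ) ≠ 0 := fun i hi => by
    exact_mod_cast (hS _ (hI i hi)).ne_zero
  have hW : #(I.image ρ) ≤ C := by
    refine card_ratio_le hU Z hZ z₀ hz₀ _ ?_
    intro w hw z hz
    obtain ⟨i, hi, rfl⟩ := mem_image.1 hw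
    obtain ⟨s, -, -, hs⟩ := h i hi z hz
    refine ⟨s / i.1, ?_⟩
    have h1 := hp i hi
    have h2 : (i.2 : ℚ) + (i.1 : ℚ) ^ 2 * z₀ = (p i : ℚ) ^ 2 := by exact_mod_cast h1
    have h3 : (i.2 : ℚ) + (i.1 : ℚ) ^ 2 * z = (s : ℚ) ^ 2 := by exact_mod_cast hs
    have := ht0 i hi
    simp only [hρ]
    push_cast
    rw [div_pow, div_pow, ← h2, ← h3]
    field_simp
    ring
  have hfib : #I ≤ r * #(I.image ρ) := by
    refine card_le_mul_card_image I r ?_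
    intro w hw
    obtain ⟨i₀, hi₀, rfl⟩ := mem_image.1 hw
    refine le_trans ?_ (hpr i₀ hi₀)
    have hcross : ∀ i ∈ I, ρ i = ρ i₀ → p i₀ * i.1 = p i * i₀.1 := by
      intro i hi he
      simp only [hρ] at he
      rw [div_eq_div_iff (ht0 i hi) (ht0 i₀ hi₀)] at he
      have he' : p i * i₀.1 = p i₀ * i.1 := by exact_mod_cast he
      exact he'.symm
    refine card_le_card_of_injOn (fun i => i.1) ?_ ?_
    · intro i hi
      simp only [mem_coe, mem_filter] at hi ⊢
      exact ⟨hI i hi.1, p i, hpR i hi.1, hcross i hi.1 hi.2⟩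
    · intro i hi j hj hij
      simp only [mem_coe, mem_filter] at hi hj
      have h1 := hcross i hi.1 hi.2
      have h2 := hcross j hj.1 hj.2
      have h3 : i.1 = j.1 := hij
      rw [h3, h2] at h1
      have h4 : p j = p i := Nat.eq_of_mul_eq_mul_right (hS _ (hI i₀ hi₀)).pos h1
      have h5 := hp i hi.1
      have h6 := hp j hj.1
      rw [← h4, h3, ← h6] at h5
      have h7 : i.2 = j.2 := by linarith
      exact Sigma.ext h3 (heq_of_eq h7)
  calc #I ≤ r * #(I.image ρ) := hfib
    _ ≤ r * C := Nat.mul_le_mul_left _ hW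
    _ = _ := mul_comm _ _

/-- The main counting inequality: if all dilates of `H` by squares of primes `t ∈ S` interact
additively with a set of squares, then `S` cannot be too large. -/
lemma card_primes_le {C : ℕ} (hU : U2 C) (S R : Finset ℕ) (hS : ∀ t ∈ S, t.Prime)
    (hR : ∀ p ∈ R, 0 < p) (hR0 : R.Nonempty) (H : Finset ℤ) {N Λ : ℝ} {r : ℕ} (hΛ0 : 0 < Λ)
    (hΛ : Real.log (#R * (1 + #S)) ≤ Λ * Real.log 2) (hr : 2 * Λ ≤ r) (hS8 : 8 * Λ ≤ #S)
    (hN0 : 0 ≤ N)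
    (hN : ∀ t ∈ S, (#(R.image (fun p : ℕ => (p : ℤ) ^ 2) -
      H.image (fun x => (t : ℤ) ^ 2 * x)) : ℝ) ≤ N) :
    (#S : ℝ) * (#R : ℝ) ^ 4 * (#H : ℝ) ^ 4 ≤
      32 * N ^ 3 * (8 * (C * r) * (#H : ℝ) ^ 4 + 1296 * (N * #S)) := by
  have hn : (0 : ℝ) < #R := by exact_mod_cast hR0.card_pos
  have hbad := card_multiple_ratios_le S R hS hR hΛ0 hΛ hr
  set d : ℕ → ℕ → ℕ := fun p t => #{t' ∈ S | ∃ p' ∈ R, p * t' = p' * t} with hd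
  set G : ℕ → Finset ℕ := fun t => {p ∈ R | ¬ r ≤ d p t} with hG
  set S' := {t ∈ S | (#R : ℝ) / 2 ≤ #(G t)} with hS'
  have hbadsum : ∑ t ∈ S, (#{p ∈ R | r ≤ d p t} : ℝ) ≤ 2 * #R * Λ := by
    refine le_trans (le_of_eq ?_) hbad
    rw [card_filter, sum_product, sum_comm]
    push_cast
    refine sum_congr rfl fun t _ => ?_
    rw [card_filter]; push_cast; rfl
  have hGc : ∀ t, (#{p ∈ R | r ≤ d p t} : ℝ) + #(G t) = #R := fun t => by
    exact_mod_cast card_filter_add_card_filter_not (s := R) (fun p => r ≤ d p t)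
  have hS'c : (#S : ℝ) / 2 ≤ #S' := by
    have h1 : (#S' : ℝ) + #{t ∈ S | ¬ (#R : ℝ) / 2 ≤ #(G t)} = #S := by
      exact_mod_cast card_filter_add_card_filter_not (s := S) (fun t => (#R : ℝ) / 2 ≤ #(G t))
    have h2 : (#{t ∈ S | ¬ (#R : ℝ) / 2 ≤ #(G t)} : ℝ) * (#R / 2) ≤ 2 * #R * Λ := by
      refine le_trans ?_ hbadsum
      rw [← nsmul_eq_mul, ← sum_const]
      refine (sum_le_sum fun t ht => ?_).trans
        (sum_le_sum_of_subset_of_nonneg (filter_subset _ _) fun _ _ _ => Nat.cast_nonneg _)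
      have := not_le.1 (mem_filter.1 ht).2
      linarith [hGc t]
    have h3 : (#{t ∈ S | ¬ (#R : ℝ) / 2 ≤ #(G t)} : ℝ) ≤ 4 * Λ := by
      have : (#{t ∈ S | ¬ (#R : ℝ) / 2 ≤ #(G t)} : ℝ) * (#R / 2) ≤ 4 * Λ * (#R / 2) := by linarith
      exact le_of_mul_le_mul_right this (by positivity)
    linarith
  set Y : ℕ → Finset ℤ := fun t => R.image (fun p : ℕ => (p : ℤ) ^ 2) -
      H.image (fun x => (t : ℤ) ^ 2 * x) with hY
  set I : Finset (Σ _ : ℕ, ℤ) := S'.sigma Y with hI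
  let rel : (Σ _ : ℕ, ℤ) → ℤ → Prop := fun i h =>
    ∃ p ∈ G i.1, i.2 + (i.1 : ℤ) ^ 2 * h = (p : ℤ) ^ 2
  classical
  have hup := sum_pow_four_le I H rel (C * r) (by
    intro Z _ hZ
    refine card_four_squares_le hU S R hS r _ ?_ Z hZ ?_
    · intro i hi
      exact (mem_filter.1 (mem_sigma.1 (mem_filter.1 hi).1).1).1
    · intro i hi z hz
      obtain ⟨p, hp, he⟩ := (mem_filter.1 hi).2 z hz
      rw [mem_filter] at hp
      exact ⟨p, hp.1, (not_le.1 hp.2).le, he⟩)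
  have hIc : (#I : ℝ) ≤ N * #S := by
    rw [hI, card_sigma]
    push_cast
    calc ∑ t ∈ S', (#(Y t) : ℝ) ≤ ∑ t ∈ S', N :=
          sum_le_sum fun t ht => hN t (mem_filter.1 ht).1
      _ = #S' * N := by simp
      _ ≤ #S * N := by gcongr; exact filter_subset _ _
      _ = _ := mul_comm _ _
  have hupR : ∑ i ∈ I, (#{h ∈ H | rel i h} : ℝ) ^ 4 ≤
      8 * (C * r) * (#H : ℝ) ^ 4 + 1296 * (N * #S) := by
    have : ∑ i ∈ I, (#{h ∈ H | rel i h} : ℝ) ^ 4 ≤ 8 * (C * r) * (#H : ℝ) ^ 4 + 1296 * #I := by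
      exact_mod_cast hup
    linarith
  have hlow : ∀ t ∈ S', (#R / 2 * #H : ℝ) ^ 4 ≤
      N ^ 3 * ∑ y ∈ Y t, (#{h ∈ H | rel ⟨t, y⟩ h} : ℝ) ^ 4 := by
    intro t ht
    have ht' := mem_filter.1 ht
    refine le_sum_pow_four (Y t) (fun y => (#{h ∈ H | rel ⟨t, y⟩ h} : ℝ))
      (by positivity) ?_ (hN t ht'.1)
    have h1 : #(G t ×ˢ H) ≤ #((Y t).sigma fun y => {h ∈ H | rel ⟨t, y⟩ h}) := by
      refine card_le_card_of_injOn (fun x => ⟨(x.1 : ℤ) ^ 2 - (t : ℤ) ^ 2 * x.2, x.2⟩) ?_ ?_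
      · rintro ⟨p, h⟩ hx
        simp only [coe_product, Set.mem_prod, mem_coe] at hx
        simp only [mem_coe, mem_sigma, mem_filter]
        refine ⟨sub_mem_sub (mem_image.2 ⟨p, (mem_filter.1 hx.1).1, rfl⟩)
          (mem_image.2 ⟨h, hx.2, rfl⟩), hx.2, p, hx.1, by ring⟩
      · rintro ⟨p, h⟩ _ ⟨p', h'⟩ _ he
        simp only [Sigma.mk.injEq, heq_eq_eq] at he
        obtain ⟨h1, rfl⟩ := he
        have h2 : (p : ℤ) ^ 2 = (p' : ℤ) ^ 2 := by linarith
        have h3 : p ^ 2 = p' ^ 2 := by exact_mod_cast h2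
        rw [Nat.pow_left_injective (by norm_num : 2 ≠ 0) h3]
    rw [card_product, card_sigma] at h1
    have h2 : (#(G t) : ℝ) * #H ≤ ∑ y ∈ Y t, (#{h ∈ H | rel ⟨t, y⟩ h} : ℝ) := by
      exact_mod_cast h1
    exact le_trans (by gcongr; exact ht'.2) h2
  have hlowsum : (#S' : ℝ) * (#R / 2 * #H : ℝ) ^ 4 ≤
      N ^ 3 * ∑ i ∈ I, (#{h ∈ H | rel i h} : ℝ) ^ 4 := by
    rw [hI, sum_sigma, mul_sum, ← nsmul_eq_mul, ← sum_const]
    exact sum_le_sum hlow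
  calc (#S : ℝ) * (#R : ℝ) ^ 4 * (#H : ℝ) ^ 4 = 32 * ((#S : ℝ) / 2 * ((#R : ℝ) / 2 * #H) ^ 4) := by ring
    _ ≤ 32 * ((#S' : ℝ) * ((#R : ℝ) / 2 * #H) ^ 4) := by gcongr
    _ ≤ 32 * (N ^ 3 * ∑ i ∈ I, (#{h ∈ H | rel i h} : ℝ) ^ 4) := by gcongr
    _ ≤ 32 * (N ^ 3 * (8 * (C * r) * (#H : ℝ) ^ 4 + 1296 * (N * #S))) := by gcongr
    _ = _ := by ring

/-- Large energy of a set of squares yields a set of small doubling containing a large piece of a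
translate of the set. -/
lemma exists_small_doubling_and_roots (A : Finset ℤ) (hA : ∀ a ∈ A, ∃ m : ℤ, a = m ^ 2) {M ν : ℝ}
    (hM : 144 ≤ M) (hν0 : 0 < ν) (hν : ν ^ 3 = #A) (hνM : M ^ 110 ≤ ν ^ 3)
    (hE : ν ^ 8 / M ≤ _root_.addEnergy A)
    (h4 : ∑ x ∈ A - A, (rep A x : ℝ) ^ 4 ≤ M * ν ^ 12) :
    ∃ P : Finset ℤ, P.Nonempty ∧ (#(P - P) : ℝ) ≤ M ^ 440 * #P ∧ ν ^ 4 / M ^ 110 ≤ #P ∧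
      (#P : ℝ) ≤ M ^ 2 * ν ^ 4 ∧ ∃ R : Finset ℕ, (∀ p ∈ R, 0 < p) ∧ ν ^ 3 / M ^ 110 ≤ #R ∧
        (#R : ℝ) ≤ ν ^ 3 ∧ ∃ b : ℤ, ∀ p ∈ R, (p : ℤ) ^ 2 - b ∈ P := by
  have hM0 : 0 < M := by linarith
  have hM1 : 1 ≤ M := by linarith
  obtain ⟨D, hDrep, hDc, hDN⟩ := exists_popular A hM hν0 hν hE h4
  have h6M : 6 * M ≤ M ^ 2 := by nlinarith
  have hDc2 : (#D : ℝ) ≤ M ^ 2 * ν ^ 4 := hDc.trans (by gcongr)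
  have hDlow : ν ^ 4 / M ^ 34 ≤ #D := by
    have h1 : (#{p ∈ D ×ˢ D | p.1 - p.2 ∈ D} : ℝ) ≤ (#D : ℝ) ^ 2 := by
      have := card_filter_le (D ×ˢ D) (fun p => p.1 - p.2 ∈ D)
      rw [card_product, ← sq] at this
      exact_mod_cast this
    have h2 : (ν ^ 4 / M ^ 34) ^ 2 ≤ (#D : ℝ) ^ 2 := by
      rw [div_pow, ← pow_mul, ← pow_mul]
      exact hDN.trans h1
    exact (le_abs_self _).trans (abs_le_of_sq_le_sq h2 (by positivity))
  have hD0 : D.Nonempty := by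
    rw [← card_pos]
    have : (0 : ℝ) < #D := lt_of_lt_of_le (by positivity) hDlow
    exact_mod_cast this
  obtain ⟨P, hPD, hPlow, hPP⟩ := exists_small_difference D (κ := 1 / M ^ 72) (by positivity) hD0 (by
    refine le_trans ?_ hDN
    calc 1 / M ^ 72 * (#D : ℝ) ^ 2 ≤ 1 / M ^ 72 * (M ^ 2 * ν ^ 4) ^ 2 := by gcongr
      _ = _ := by field_simp)
  have hPlow2 : ν ^ 4 / M ^ 107 ≤ #P := by
    calc ν ^ 4 / M ^ 107 = 4 * (ν ^ 4 / (4 * M ^ 107)) := by field_simp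
      _ ≤ M * (ν ^ 4 / (4 * M ^ 107)) := by gcongr; linarith
      _ = 1 / M ^ 72 * (ν ^ 4 / M ^ 34) / 4 := by field_simp
      _ ≤ 1 / M ^ 72 * #D / 4 := by gcongr
      _ ≤ _ := hPlow
  have hP0 : (0 : ℝ) < #P := lt_of_lt_of_le (by positivity) hPlow2
  have hrepsum : ∑ b ∈ A, #{a ∈ A | a - b ∈ P} = ∑ x ∈ P, rep A x := by
    simp only [rep, card_filter, sum_product]
    rw [sum_comm]
    rw [sum_comm (s := P)]
    refine sum_congr rfl fun a _ => ?_
    rw [sum_comm (s := P)]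
    refine sum_congr rfl fun b _ => ?_
    rw [sum_ite_eq]
  obtain ⟨b, -, hb⟩ : ∃ b ∈ A, ν ^ 3 / M ^ 109 ≤ (#{a ∈ A | a - b ∈ P} : ℝ) := by
    have hAne : A.Nonempty := by
      rw [← card_pos]
      have : (0 : ℝ) < #A := by rw [← hν]; positivity
      exact_mod_cast this
    refine exists_le_of_sum_le hAne ?_
    have h1 : ∑ b ∈ A, (#{a ∈ A | a - b ∈ P} : ℝ) = ∑ x ∈ P, (rep A x : ℝ) := by
      exact_mod_cast hrepsum
    rw [h1, sum_const, nsmul_eq_mul, ← hν]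
    calc ν ^ 3 * (ν ^ 3 / M ^ 109) = (ν ^ 4 / M ^ 107) * (ν ^ 2 / M ^ 2) := by field_simp
      _ ≤ #P * (ν ^ 2 / (6 * M)) := by gcongr
      _ = ∑ x ∈ P, ν ^ 2 / (6 * M) := by rw [sum_const, nsmul_eq_mul]
      _ ≤ _ := sum_le_sum fun x hx => hDrep x (hPD hx)
  set B := {a ∈ A | a - b ∈ P}.erase 0 with hB
  have hsq : ∀ a ∈ B, a ≠ 0 ∧ ((Nat.sqrt a.natAbs : ℕ) : ℤ) ^ 2 = a := by
    intro a ha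
    have h1 := mem_erase.1 ha
    obtain ⟨m, rfl⟩ := hA a (mem_filter.1 h1.2).1
    refine ⟨h1.1, ?_⟩
    rw [Int.natAbs_pow, Nat.sqrt_eq', Int.natCast_natAbs, sq_abs]
  refine ⟨P, card_pos.1 (by exact_mod_cast hP0), ?_, ?_, ?_, B.image fun a => Nat.sqrt a.natAbs,
    ?_, ?_, ?_, b, ?_⟩
  · have h1 : (#(P - P) : ℝ) ≤ 1024 * M ^ 360 * #D := by
      have : (#(P - P) : ℝ) * (1 / M ^ 72) ^ 5 * M ^ 360 ≤ 1024 * #D * M ^ 360 := by gcongr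
      calc (#(P - P) : ℝ) = (#(P - P) : ℝ) * (1 / M ^ 72) ^ 5 * M ^ 360 := by field_simp
        _ ≤ _ := this
        _ = _ := by ring
    have h2 : (#D : ℝ) ≤ 4 * M ^ 72 * #P := by
      calc (#D : ℝ) = (1 / M ^ 72 * #D / 4) * (4 * M ^ 72) := by field_simp
        _ ≤ #P * (4 * M ^ 72) := by gcongr
        _ = _ := by ring
    have h3 : (4096 : ℝ) ≤ M ^ 2 := by nlinarith
    calc (#(P - P) : ℝ) ≤ 1024 * M ^ 360 * (4 * M ^ 72 * #P) := h1.trans (by gcongr)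
      _ = 4096 * M ^ 432 * #P := by ring
      _ ≤ M ^ 2 * M ^ 432 * #P := by gcongr
      _ = M ^ 434 * #P := by ring
      _ ≤ _ := by gcongr; norm_num
  · exact le_trans (by gcongr; norm_num) hPlow2
  · exact le_trans (by exact_mod_cast card_le_card hPD) hDc2
  · intro p hp
    obtain ⟨a, ha, rfl⟩ := mem_image.1 hp
    rw [Nat.sqrt_pos]
    exact Int.natAbs_pos.2 (hsq a ha).1
  · rw [card_image_of_injOn (by
      intro x hx y hy hxy
      rw [← (hsq x hx).2, ← (hsq y hy).2]
      simp only at hxy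
      rw [hxy])]
    have h1 := pred_card_le_card_erase (a := (0 : ℤ)) (s := {a ∈ A | a - b ∈ P})
    rw [← hB] at h1
    have h2 : (#{a ∈ A | a - b ∈ P} : ℝ) ≤ #B + 1 := by
      have : #{a ∈ A | a - b ∈ P} ≤ #B + 1 := by omega
      exact_mod_cast this
    have h3 : 1 ≤ ν ^ 3 / M ^ 110 := by rwa [one_le_div (by positivity)]
    have h4 : 2 * (ν ^ 3 / M ^ 110) ≤ ν ^ 3 / M ^ 109 := by
      calc 2 * (ν ^ 3 / M ^ 110) ≤ M * (ν ^ 3 / M ^ 110) := by gcongr; linarith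
        _ = _ := by field_simp
    linarith
  · rw [hν]
    exact_mod_cast card_image_le.trans ((card_erase_le).trans (card_filter_le _ _))
  · intro p hp
    obtain ⟨a, ha, rfl⟩ := mem_image.1 hp
    rw [(hsq a ha).2]
    exact (mem_filter.1 (mem_erase.1 ha).2).2

/-- A crude lower bound for the number of primes up to a square. -/
lemma exists_primes_le_sq {Y : ℕ} (hY : 12 ≤ Y) :
    ∃ S : Finset ℕ, (∀ t ∈ S, t.Prime ∧ t ≤ Y ^ 2) ∧ (Y : ℝ) / 4 ≤ #S ∧ #S ≤ Y ^ 2 := by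
  refine ⟨{t ∈ Ioc 0 (Y ^ 2) | t.Prime}, ?_, ?_, ?_⟩
  · intro t ht
    rw [mem_filter, mem_Ioc] at ht
    exact ⟨ht.2, ht.1.2⟩
  · have hc : #{t ∈ Ioc 0 (Y ^ 2) | t.Prime} = Nat.primeCounting (Y ^ 2) := by
      rw [Nat.primeCounting, Nat.primeCounting', Nat.count_eq_card_filter_range]
      congr 1
      ext t
      simp only [mem_filter, mem_Ioc, mem_range]
      constructor
      · rintro ⟨⟨_, h⟩, hp⟩; exact ⟨by omega, hp⟩
      · rintro ⟨h, hp⟩; exact ⟨⟨hp.pos, by omega⟩, hp⟩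
    rw [hc]
    have h1 := Chebyshev.pi_ge (Y ^ 2)
    refine le_trans ?_ h1
    have hY' : (12 : ℝ) ≤ Y := by exact_mod_cast hY
    have hY0 : (0 : ℝ) < Y := by linarith
    have hlogpos : 0 < Real.log Y := Real.log_pos (by linarith)
    have hlog : Real.log Y ≤ Y - 1 := Real.log_le_sub_one_of_pos hY0
    have hlog2 := Real.log_two_gt_d9
    have h3 : Real.log ((Y : ℝ) ^ 2 + 1) ≤ 2 * Y := by
      calc Real.log ((Y : ℝ) ^ 2 + 1) ≤ Real.log ((Y + 1 : ℝ) ^ 2) :=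
            Real.log_le_log (by positivity) (by nlinarith)
        _ = 2 * Real.log (Y + 1 : ℝ) := by rw [Real.log_pow]; norm_num
        _ ≤ 2 * Y := by
            have := Real.log_le_sub_one_of_pos (by positivity : (0 : ℝ) < Y + 1)
            linarith
    push_cast
    rw [Real.log_pow, le_div_iff₀ (by push_cast; positivity)]
    push_cast
    nlinarith
  · refine (card_filter_le _ _).trans ?_
    simp

lemma card_sq_sub_dilate_le (P H : Finset ℤ) (R : Finset ℕ) (hP : P.Nonempty) {K : ℝ}
    (hK : (#(P - P) : ℝ) ≤ K * #P) {b u : ℤ} (hR : ∀ p ∈ R, (p : ℤ) ^ 2 - b ∈ P) (w : ℤ)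
    (hu : ∀ h ∈ H, w * h - u ∈ P - P + P - P) :
    (#(R.image (fun p : ℕ => (p : ℤ) ^ 2) - H.image (fun x => w * x)) : ℝ) ≤ K ^ 5 * #P := by
  refine le_trans ?_ (card_nsmul_sub_nsmul_le P hP hK 3 2)
  have hsub : R.image (fun p : ℕ => (p : ℤ) ^ 2) - H.image (fun x => w * x) ⊆
      (3 • P - 2 • P).image (fun x => x + (b - u)) := by
    intro x hx
    obtain ⟨y, hy, z, hz, rfl⟩ := mem_sub.1 hx
    obtain ⟨p, hp, rfl⟩ := mem_image.1 hy
    obtain ⟨h, hh, rfl⟩ := mem_image.1 hz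
    obtain ⟨s, hs, p₄, hp₄, h₁⟩ := mem_sub.1 (hu h hh)
    obtain ⟨s', hs', p₃, hp₃, rfl⟩ := mem_add.1 hs
    obtain ⟨p₁, hp₁, p₂, hp₂, rfl⟩ := mem_sub.1 hs'
    refine mem_image.2 ⟨((p : ℤ) ^ 2 - b + p₂ + p₄) - (p₁ + p₃), ?_, by linarith⟩
    refine sub_mem_sub ?_ ?_
    · rw [succ_nsmul, two_nsmul]
      exact add_mem_add (add_mem_add (hR p hp) hp₂) hp₄
    · rw [two_nsmul]
      exact add_mem_add hp₁ hp₃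
  exact_mod_cast (card_le_card hsub).trans card_image_le

/-- The numerical parameters used in the choice of almost periods. -/
lemma exists_dilation_parameters {l : ℝ} (hl : 10 ^ 10 ≤ l) :
    ∃ L m : ℕ, 1 ≤ L ∧
      8 * L * Real.exp (440 * l) ^ 3 * Real.exp (-(m / (64 * (L : ℝ) ^ 2))) < 1 ∧
      Real.exp (28204 * l) < 2 ^ L ∧
      (2 * Real.exp (440 * l) ^ (2 * m + 3 * L + 1)) ^ L ≤ Real.exp (l ^ 11 / 2) := by
  have hl0 : 0 < l := by linarith [show (0 : ℝ) < 10 ^ 10 by norm_num]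
  have hl1 : 1 ≤ l := le_trans (by norm_num) hl
  set L := ⌈50000 * l⌉₊ with hL
  set m := ⌈64 * (L : ℝ) ^ 2 * (1400 * l)⌉₊ with hm
  have hL1 : 50000 * l ≤ L := Nat.le_ceil _
  have hL2 : (L : ℝ) ≤ 50001 * l := by
    have := Nat.ceil_lt_add_one (show 0 ≤ 50000 * l by positivity)
    linarith
  have hL0 : (0 : ℝ) < L := lt_of_lt_of_le (by positivity) hL1
  have hm1 : 64 * (L : ℝ) ^ 2 * (1400 * l) ≤ m := Nat.le_ceil _
  have hm2 : (m : ℝ) ≤ 230000000000000 * l ^ 3 := by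
    have h1 := Nat.ceil_lt_add_one (show 0 ≤ 64 * (L : ℝ) ^ 2 * (1400 * l) by positivity)
    have h2 : 64 * (L : ℝ) ^ 2 * (1400 * l) ≤ 64 * (50001 * l) ^ 2 * (1400 * l) := by gcongr
    have h3 : 1 ≤ l ^ 3 := one_le_pow₀ hl1
    calc (m : ℝ) ≤ 64 * (50001 * l) ^ 2 * (1400 * l) + 1 := by linarith
      _ = 224008960089600 * l ^ 3 + 1 := by ring
      _ ≤ _ := by linarith
  have h2e : (2 : ℝ) ≤ Real.exp l := by linarith [Real.add_one_le_exp l]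
  refine ⟨L, m, by exact_mod_cast hL0, ?_, ?_, ?_⟩
  · have h1 : Real.exp (-(m / (64 * (L : ℝ) ^ 2))) ≤ Real.exp (-(1400 * l)) := by
      rw [Real.exp_le_exp, neg_le_neg_iff, le_div_iff₀ (by positivity)]
      linarith
    have h2 : 8 * (L : ℝ) ≤ Real.exp l := by
      have := Real.quadratic_le_exp_of_nonneg hl0.le
      nlinarith
    rw [← Real.exp_nat_mul]
    calc 8 * L * Real.exp ((3 : ℕ) * (440 * l)) * Real.exp (-(m / (64 * (L : ℝ) ^ 2)))
        ≤ Real.exp l * Real.exp ((3 : ℕ) * (440 * l)) * Real.exp (-(1400 * l)) := by gcongr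
      _ = Real.exp (-(79 * l)) := by
          rw [← Real.exp_add, ← Real.exp_add]; congr 1; push_cast; ring
      _ < 1 := by rw [Real.exp_lt_one_iff]; linarith
  · rw [← Real.exp_log (show (0 : ℝ) < 2 by norm_num), ← Real.exp_nat_mul, Real.exp_lt_exp]
    have := Real.log_two_gt_d9
    nlinarith
  · have hexp : 2 * Real.exp (440 * l) ^ (2 * m + 3 * L + 1) ≤
        Real.exp (230000000000000000 * l ^ 4) := by
      rw [← Real.exp_nat_mul]
      have h1 : ((2 * m + 3 * L + 1 : ℕ) : ℝ) ≤ 500000000000000 * l ^ 3 := by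
        have h3 : 1 ≤ l ^ 3 := one_le_pow₀ hl1
        have h4 : l ≤ l ^ 3 := le_self_pow₀ hl1 (by norm_num)
        push_cast
        linarith
      calc 2 * Real.exp ((2 * m + 3 * L + 1 : ℕ) * (440 * l))
          ≤ Real.exp l * Real.exp (500000000000000 * l ^ 3 * (440 * l)) := by gcongr
        _ = Real.exp (l + 220000000000000000 * l ^ 4) := by
            rw [← Real.exp_add]; congr 1; ring
        _ ≤ _ := by
            rw [Real.exp_le_exp]
            have h4 : l ≤ l ^ 4 := le_self_pow₀ hl1 (by norm_num)
            linarith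
    calc (2 * Real.exp (440 * l) ^ (2 * m + 3 * L + 1)) ^ L
        ≤ Real.exp (230000000000000000 * l ^ 4) ^ L := by gcongr
      _ = Real.exp (L * (230000000000000000 * l ^ 4)) := by rw [← Real.exp_nat_mul]
      _ ≤ Real.exp (l ^ 11 / 2) := by
          rw [Real.exp_le_exp]
          have h6 : (10 ^ 10 : ℝ) ^ 6 ≤ l ^ 6 := by gcongr
          calc (L : ℝ) * (230000000000000000 * l ^ 4)
              ≤ 50001 * l * (230000000000000000 * l ^ 4) := by gcongr
            _ = (50001 * 230000000000000000) * l ^ 5 := by ring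
            _ ≤ l ^ 6 / 2 * l ^ 5 := by
                gcongr
                refine le_trans ?_ (div_le_div_of_nonneg_right h6 (by norm_num))
                norm_num
            _ = l ^ 11 / 2 := by ring

lemma false_of_dilate_bounds {M ν c r T ρ h : ℝ} (hM : 100000 ≤ M) (hν : 0 < ν)
    (hc : 8 * c ≤ M) (hr0 : 0 ≤ r) (hr : r ≤ M) (hT : M ^ 7050 ≤ T) (hρ : ν ^ 3 / M ^ 110 ≤ ρ)
    (hh : M ^ 2313 * ν ≤ h)
    (H : T * ρ ^ 4 * h ^ 4 ≤ 32 * (M ^ 2202 * ν ^ 4) ^ 3 *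
      (8 * (c * r) * h ^ 4 + 1296 * ((M ^ 2202 * ν ^ 4) * T))) : False := by
  have hM0 : 0 < M := by linarith
  have hT0 : 0 < T := lt_of_lt_of_le (by positivity) hT
  have hh0 : 0 < h := lt_of_lt_of_le (by positivity) hh
  have h1 : T * h ^ 4 ≤ 32 * M ^ 7048 * h ^ 4 + 41472 * M ^ 9248 * ν ^ 4 * T := by
    have e1 : T * (ν ^ 3 / M ^ 110) ^ 4 * h ^ 4 ≤ 32 * (M ^ 2202 * ν ^ 4) ^ 3 *
        ((M * M) * h ^ 4 + 1296 * ((M ^ 2202 * ν ^ 4) * T)) := by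
      calc T * (ν ^ 3 / M ^ 110) ^ 4 * h ^ 4 ≤ T * ρ ^ 4 * h ^ 4 := by gcongr
        _ ≤ _ := H
        _ = 32 * (M ^ 2202 * ν ^ 4) ^ 3 *
          ((8 * c) * r * h ^ 4 + 1296 * ((M ^ 2202 * ν ^ 4) * T)) := by ring
        _ ≤ _ := by gcongr
    have e2 : T * (ν ^ 3 / M ^ 110) ^ 4 * h ^ 4 = (T * h ^ 4) * (ν ^ 12 / M ^ 440) := by
      rw [div_pow, ← pow_mul, ← pow_mul]; ring
    have e3 : 32 * (M ^ 2202 * ν ^ 4) ^ 3 *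
        ((M * M) * h ^ 4 + 1296 * ((M ^ 2202 * ν ^ 4) * T)) =
        (32 * M ^ 7048 * h ^ 4 + 41472 * M ^ 9248 * ν ^ 4 * T) * (ν ^ 12 / M ^ 440) := by
      field_simp
      ring
    rw [e2, e3] at e1
    exact le_of_mul_le_mul_right e1 (by positivity)
  have hMM : 100000 ≤ M ^ 2 := by nlinarith
  have h2 : 32 * M ^ 7048 * h ^ 4 ≤ T / 4 * h ^ 4 := by
    gcongr
    have : 100000 * M ^ 7048 ≤ M ^ 7050 := by
      calc 100000 * M ^ 7048 ≤ M ^ 2 * M ^ 7048 := by gcongr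
        _ = M ^ 7050 := (pow_add M 2 7048).symm
    have : 0 < M ^ 7048 := by positivity
    linarith
  have h3 : 41472 * M ^ 9248 * ν ^ 4 * T ≤ h ^ 4 / 2 * T := by
    gcongr
    have e1 : (M ^ 2313 * ν) ^ 4 ≤ h ^ 4 := by gcongr
    have e2 : 100000 * M ^ 9248 ≤ M ^ 4 * M ^ 9248 := by
      gcongr
      exact hMM.trans (pow_le_pow_right₀ (by linarith) (by norm_num))
    have e3 : 100000 * M ^ 9248 * ν ^ 4 ≤ M ^ 4 * M ^ 9248 * ν ^ 4 := by gcongr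
    have e4 : (M ^ 2313 * ν) ^ 4 = M ^ 4 * M ^ 9248 * ν ^ 4 := by
      rw [mul_pow, ← pow_mul, ← pow_add]
    have : 0 < M ^ 9248 * ν ^ 4 := by positivity
    linarith
  have : 0 < T * h ^ 4 := by positivity
  linarith

lemma mul_pow_eleven_le_exp {l : ℝ} (hl : 10 ^ 11 ≤ l) : 32 * l ^ 11 ≤ Real.exp l := by
  have hl0 : 0 < l := by linarith [show (0 : ℝ) < 10 ^ 11 by norm_num]
  refine le_trans ?_ (Real.pow_div_factorial_le_exp l hl0.le 12)
  rw [le_div_iff₀ (by positivity), pow_succ l 11,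
    show ((12 : ℕ).factorial : ℝ) = 479001600 by norm_num [Nat.factorial]]
  have : l ^ 11 * 10 ^ 11 ≤ l ^ 11 * l := by gcongr
  have : 0 < l ^ 11 := by positivity
  linarith

/-- The energy bound for large sets of squares. -/
lemma addEnergy_le_of_large {C : ℕ} (hU : U2 C) (A : Finset ℤ)
    (hA : ∀ a ∈ A, ∃ m : ℤ, a = m ^ 2) {l : ℝ} (hl : 10 ^ 11 ≤ l) (hlC : 8 * C + 1296 ≤ l)
    (hAl : (#A : ℝ) = Real.exp (l ^ 11)) :
    (_root_.addEnergy A : ℝ) ≤ Real.exp (l ^ 11 / 3) ^ 8 / Real.exp l := by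
  by_contra! hE
  have hl0 : 0 < l := by linarith [show (0 : ℝ) < 10 ^ 11 by norm_num]
  have hl1 : 1 ≤ l := le_trans (by norm_num) hl
  have hl11 : 100000 * l ≤ l ^ 11 := by
    have : (10 ^ 11 : ℝ) ^ 10 ≤ l ^ 10 := by gcongr
    nlinarith
  have hlog2 := Real.log_two_gt_d9
  have h32 := mul_pow_eleven_le_exp hl
  set M := Real.exp l with hM
  set ν := Real.exp (l ^ 11 / 3) with hν
  have hMpow : ∀ k : ℕ, M ^ k = Real.exp (k * l) := fun k => by rw [hM, ← Real.exp_nat_mul]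
  have hν3 : ν ^ 3 = Real.exp (l ^ 11) := by
    rw [hν, ← Real.exp_nat_mul]; congr 1; push_cast; ring
  have hlM : l + 1 ≤ M := Real.add_one_le_exp l
  have hM5 : 100000 ≤ M := by linarith [show (100000 : ℝ) ≤ 10 ^ 11 by norm_num]
  have hM0 : 0 < M := by linarith
  have hM1 : 1 ≤ M := by linarith
  have hν0 : 0 < ν := Real.exp_pos _
  have h4 : ∑ x ∈ A - A, (rep A x : ℝ) ^ 4 ≤ M * ν ^ 12 := by
    have h1 : ∑ x ∈ A - A, (rep A x : ℝ) ^ 4 ≤ (8 * C + 1296) * (#A : ℝ) ^ 4 := by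
      exact_mod_cast sum_rep_pow_four_le hU A hA
    refine h1.trans ?_
    rw [hAl, ← hν3, ← pow_mul]
    gcongr
    linarith
  obtain ⟨P, hP, hPP, hPlow, hPup, R, hR0, hRlow, hRup, b, hRP⟩ :=
    exists_small_doubling_and_roots A hA (M := M) (ν := ν) (by linarith) hν0 (hν3.trans hAl.symm)
      (by rw [hMpow, hν3, Real.exp_le_exp]; push_cast; linarith) hE.le h4
  obtain ⟨L, m, hL, hm, hL2, hLm⟩ := exists_dilation_parameters (le_trans (by norm_num) hl)
  have hK : Real.exp (440 * l) = M ^ 440 := by rw [hMpow]; norm_num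
  rw [hK] at hm hLm
  obtain ⟨H, -, hHlow, hH⟩ := exists_subset_dilates P hP (one_le_pow₀ hM1) hPP hL hm
  set Y := ⌈4 * M ^ 7050⌉₊ with hY
  have hY1 : 4 * M ^ 7050 ≤ Y := Nat.le_ceil _
  have hM7050 : M ≤ M ^ 7050 := le_self_pow₀ hM1 (by norm_num)
  have hY2 : (Y : ℝ) ≤ M ^ 7051 := by
    have h1 := Nat.ceil_lt_add_one (show 0 ≤ 4 * M ^ 7050 by positivity)
    have h2 : 5 * M ^ 7050 ≤ M * M ^ 7050 := by gcongr; linarith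
    have h3 : M * M ^ 7050 = M ^ 7051 := (pow_succ' M 7050).symm
    rw [← hY] at h1
    linarith
  obtain ⟨S, hS, hSlow, hSup⟩ := exists_primes_le_sq (Y := Y) (by
    have : (12 : ℝ) ≤ Y := by linarith
    exact_mod_cast this)
  have hT : M ^ 7050 ≤ #S := by linarith
  have hT2 : (#S : ℝ) ≤ M ^ 14102 := by
    calc (#S : ℝ) ≤ (Y : ℝ) ^ 2 := by exact_mod_cast hSup
      _ ≤ (M ^ 7051) ^ 2 := by gcongr
      _ = _ := by rw [← pow_mul]
  have hRpos : (0 : ℝ) < #R := lt_of_lt_of_le (by positivity) hRlow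
  have hN : ∀ t ∈ S, (#(R.image (fun p : ℕ => (p : ℤ) ^ 2) -
      H.image (fun x => (t : ℤ) ^ 2 * x)) : ℝ) ≤ M ^ 2202 * ν ^ 4 := by
    intro t ht
    have ht2 : t ^ 2 < 2 ^ L := by
      have h1 : (t : ℝ) ≤ (M ^ 7051) ^ 2 := by
        calc (t : ℝ) ≤ (Y : ℝ) ^ 2 := by exact_mod_cast (hS t ht).2
          _ ≤ _ := by gcongr
      have h2 : (t : ℝ) ^ 2 < 2 ^ L := by
        refine lt_of_le_of_lt ?_ hL2
        calc (t : ℝ) ^ 2 ≤ ((M ^ 7051) ^ 2) ^ 2 := by gcongr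
          _ = M ^ 28204 := by rw [← pow_mul, ← pow_mul]
          _ ≤ _ := by rw [hMpow]; norm_num
      exact_mod_cast h2
    obtain ⟨u, hu⟩ := hH (t ^ 2) ht2
    refine (card_sq_sub_dilate_le P H R hP hPP hRP ((t : ℤ) ^ 2) (u := u) (by
      exact_mod_cast hu)).trans ?_
    calc (M ^ 440) ^ 5 * (#P : ℝ) ≤ (M ^ 440) ^ 5 * (M ^ 2 * ν ^ 4) := by gcongr
      _ = _ := by rw [← pow_mul, ← mul_assoc, ← pow_add]
  have hlogRS : Real.log (#R * (1 + #S)) ≤ 4 * l ^ 11 * Real.log 2 := by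
    have h1 : (1 + #S : ℝ) ≤ M ^ 14103 := by
      have e1 : 2 * M ^ 14102 ≤ M * M ^ 14102 := by gcongr; linarith
      have e3 : M * M ^ 14102 = M ^ 14103 := (pow_succ' M 14102).symm
      have e2 : 1 ≤ M ^ 14102 := one_le_pow₀ hM1
      linarith
    have h2 : (#R * (1 + #S) : ℝ) ≤ Real.exp (l ^ 11 + 14103 * l) := by
      rw [Real.exp_add]
      rw [hMpow] at h1
      rw [hν3] at hRup
      exact mul_le_mul hRup (by exact_mod_cast h1) (by positivity) (by positivity)
    rw [Real.log_le_iff_le_exp (by positivity)]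
    refine h2.trans ?_
    rw [Real.exp_le_exp]
    nlinarith
  have hrup : ((⌈8 * l ^ 11⌉₊ : ℕ) : ℝ) ≤ M := by
    have h1 := Nat.ceil_lt_add_one (show 0 ≤ 8 * l ^ 11 by positivity)
    have h2 : 1 ≤ l ^ 11 := one_le_pow₀ hl1
    linarith
  have hHlow2 : M ^ 2313 * ν ≤ #H := by
    have h1 : (#P : ℝ) ≤ Real.exp (l ^ 11 / 2) * #H :=
      hHlow.trans (by gcongr)
    have h2 : ν ^ 4 / M ^ 110 ≤ Real.exp (l ^ 11 / 2) * #H := hPlow.trans h1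
    have h3 : ν ^ 4 = Real.exp (l ^ 11) * ν := by rw [← hν3]; ring
    rw [div_le_iff₀ (by positivity), h3] at h2
    have h5 : Real.exp (l ^ 11 / 2) * M ^ 110 * M ^ 2313 ≤ Real.exp (l ^ 11) := by
      rw [mul_assoc, ← pow_add, hMpow, ← Real.exp_add, Real.exp_le_exp]
      push_cast
      linarith
    have h6 : (Real.exp (l ^ 11 / 2) * M ^ 110) * (M ^ 2313 * ν) ≤
        (Real.exp (l ^ 11 / 2) * M ^ 110) * #H := by
      calc _ = Real.exp (l ^ 11 / 2) * M ^ 110 * M ^ 2313 * ν := by ring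
        _ ≤ Real.exp (l ^ 11) * ν := by gcongr
        _ ≤ _ := h2
        _ = _ := by ring
    exact le_of_mul_le_mul_left h6 (by positivity)
  have hmain := card_primes_le hU S R (fun t ht => (hS t ht).1) hR0
    (card_pos.1 (by exact_mod_cast hRpos)) H (N := M ^ 2202 * ν ^ 4) (Λ := 4 * l ^ 11)
    (r := ⌈8 * l ^ 11⌉₊) (by positivity) hlogRS ((by ring : 2 * (4 * l ^ 11) = 8 * l ^ 11).trans_le
      (Nat.le_ceil _)) (by linarith) (by positivity) hN
  exact false_of_dilate_bounds hM5 hν0 (by linarith) (Nat.cast_nonneg _) hrup hT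
    hRlow hHlow2 hmain

/-- conditionally, for any `0 < α < 1/11` the additive energy of a set of
squares satisfies `E(A) ≤ C₀·|A|^{8/3}·exp(−c·(log |A|)^α)`. -/
theorem squares_energy (C : ℕ) (hC : 1 ≤ C) (hU : U2 C) :
    ∀ α : ℝ, 0 < α → α < 1 / 11 →
      ∃ c C₀ : ℝ, 0 < c ∧ 1 ≤ C₀ ∧
        ∀ (A : Finset ℤ), (∀ a ∈ A, ∃ m : ℤ, a = m ^ 2) → 2 ≤ A.card →
          (addEnergy A : ℝ) ≤
            C₀ * (A.card : ℝ) ^ ((8 : ℝ) / 3) *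
              Real.exp (-c * Real.log (A.card : ℝ) ^ α) := by
  intro α hα0 hα
  set l₀ : ℝ := 10 ^ 11 + (8 * C + 1296) with hl₀
  have hl₀1 : 1 ≤ l₀ := by
    have : (0 : ℝ) ≤ C := Nat.cast_nonneg C
    rw [hl₀]; linarith
  refine ⟨1, Real.exp (2 * l₀ ^ 11), one_pos, Real.one_le_exp (by positivity), fun A hA hA2 => ?_⟩
  have hn : (2 : ℝ) ≤ #A := by exact_mod_cast hA2
  have hn0 : (0 : ℝ) < #A := by linarith
  have hlog0 : 0 < Real.log #A := Real.log_pos (by linarith)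
  rw [Real.rpow_def_of_pos hn0, ← Real.exp_add, ← Real.exp_add]
  set g := Real.log (#A : ℝ) with hg
  have hexp : (#A : ℝ) = Real.exp g := (Real.exp_log hn0).symm
  rcases le_total (l₀ ^ 11) g with h | h
  · set l := g ^ (1 / 11 : ℝ) with hl
    have hl11 : l ^ 11 = g := by
      rw [hl, ← Real.rpow_natCast, ← Real.rpow_mul hlog0.le]; norm_num
    have hll : l₀ ≤ l := by
      refine le_of_pow_le_pow_left₀ (n := 11) (by norm_num) (by positivity) ?_
      rwa [hl11]
    have hC0 : (0 : ℝ) ≤ C := Nat.cast_nonneg C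
    have hmain := addEnergy_le_of_large hU A hA (l := l) (by linarith)
      (by linarith [show (0 : ℝ) < 10 ^ 11 by norm_num]) (by rw [hl11, hexp])
    refine hmain.trans ?_
    rw [← Real.exp_nat_mul, ← Real.exp_sub, Real.exp_le_exp, hl11]
    have hg1 : 1 ≤ g := (one_le_pow₀ hl₀1).trans h
    have hgα : g ^ α ≤ l := Real.rpow_le_rpow_of_exponent_le hg1 hα.le
    have : 0 ≤ l₀ ^ 11 := by positivity
    push_cast
    linarith
  · refine (addEnergy_le A).trans ?_
    rw [hexp, ← Real.exp_nat_mul, Real.exp_le_exp]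
    have hl1 : 1 ≤ l₀ ^ 11 := one_le_pow₀ hl₀1
    have hgα : g ^ α ≤ l₀ ^ 11 := by
      calc g ^ α ≤ (l₀ ^ 11) ^ α := by gcongr
        _ ≤ (l₀ ^ 11) ^ (1 : ℝ) := Real.rpow_le_rpow_of_exponent_le hl1 (by linarith)
        _ = _ := Real.rpow_one _
    push_cast
    linarith
end

section
/- Assume Hypothesis (U5). Then there exists a constant K ≥ 1 (depending only on the constant C from (U5)) such that for all finite sets A, B ⊆ ℤ with 5 ≤ |A| ≤ |B|, the number of pairs (a, b) ∈ A × B such that a + b is a perfect square is at most K·(|A|·|B|^{4/5} + |B|). -/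
open Finset

/-- Hypothesis (U5): an instance of the Uniformity Conjecture for the genus-two curves
`y² = (x + a₁)⋯(x + a₅)` with pairwise distinct `aᵢ`. -/
def U5 (C : ℕ) : Prop :=
  ∀ a : Fin 5 → ℤ, Function.Injective a →
    {p : ℚ × ℚ | p.2 ^ 2 = ∏ i, (p.1 + (a i : ℚ))}.Finite ∧
    {p : ℚ × ℚ | p.2 ^ 2 = ∏ i, (p.1 + (a i : ℚ))}.ncard ≤ C

/-- The elements of `A` whose sum with `b` is a perfect square. -/
noncomputable def squareNeighbors (A : Finset ℤ) (b : ℤ) : Finset ℤ :=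
  open Classical in A.filter fun a => ∃ m : ℤ, a + b = m ^ 2

theorem U5.card_common_le {C : ℕ} (hU : U5 C) (A B S : Finset ℤ) (hS : S.card = 5) :
    (B.filter fun b => S ⊆ squareNeighbors A b).card ≤ C := by
  classical
  let a : Fin 5 → ℤ := fun i => S.orderEmbOfFin hS i
  obtain ⟨hfin, hcard⟩ := hU a (S.orderEmbOfFin hS).injective
  refine le_trans ?_ hcard
  have key : ∀ b ∈ B.filter (fun b => S ⊆ squareNeighbors A b),
      ∃ y : ℚ, y ^ 2 = ∏ i, ((b : ℚ) + (a i : ℚ)) := by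
    intro b hb
    have hsub := (Finset.mem_filter.1 hb).2
    have hm : ∀ i, ∃ m : ℤ, a i + b = m ^ 2 := fun i =>
      (Finset.mem_filter.1 (hsub (S.orderEmbOfFin_mem hS i))).2
    choose m hm using hm
    refine ⟨∏ i, (m i : ℚ), ?_⟩
    rw [← Finset.prod_pow]
    refine Finset.prod_congr rfl fun i _ => ?_
    have h : ((a i + b : ℤ) : ℚ) = ((m i ^ 2 : ℤ) : ℚ) := by rw [hm i]
    push_cast at h
    rw [← h, add_comm]
  choose! y hy using key
  rw [← Set.ncard_coe_finset]
  refine Set.ncard_le_ncard_of_injOn (fun b : ℤ => ((b : ℚ), y b)) (fun b hb => hy b hb) ?_ hfin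
  intro b _ b' _ h
  exact Int.cast_injective (α := ℚ) (congrArg Prod.fst h)

theorem U5.sum_choose_le {C : ℕ} (hU : U5 C) (A B : Finset ℤ) :
    ∑ b ∈ B, (squareNeighbors A b).card.choose 5 ≤ C * A.card.choose 5 := by
  classical
  have h := Finset.sum_card_bipartiteAbove_eq_sum_card_bipartiteBelow
    (s := B) (t := A.powersetCard 5) (fun b S => S ⊆ squareNeighbors A b)
  have hab : ∀ b ∈ B, (squareNeighbors A b).card.choose 5 =
      ((A.powersetCard 5).bipartiteAbove (fun b S => S ⊆ squareNeighbors A b) b).card := by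
    intro b _
    rw [← Finset.card_powersetCard]
    congr 1
    ext S
    simp only [Finset.bipartiteAbove, Finset.mem_filter, Finset.mem_powersetCard]
    exact ⟨fun ⟨h1, h2⟩ => ⟨⟨h1.trans (Finset.filter_subset _ _), h2⟩, h1⟩,
      fun ⟨⟨_, h2⟩, h1⟩ => ⟨h1, h2⟩⟩
  rw [Finset.sum_congr rfl hab, h, mul_comm, ← Finset.card_powersetCard, ← smul_eq_mul]
  exact Finset.sum_le_card_nsmul _ _ _ fun S hS =>
    hU.card_common_le A B S (Finset.mem_powersetCard.1 hS).2

theorem U5.sum_sub_pow_le {C : ℕ} (hU : U5 C) (A B : Finset ℤ) :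
    ∑ b ∈ B, ((squareNeighbors A b).card - 4) ^ 5 ≤ C * A.card ^ 5 := by
  calc ∑ b ∈ B, ((squareNeighbors A b).card - 4) ^ 5
      ≤ ∑ b ∈ B, Nat.factorial 5 * (squareNeighbors A b).card.choose 5 := by
        refine Finset.sum_le_sum fun b _ => ?_
        rw [← Nat.descFactorial_eq_factorial_mul_choose]
        exact Nat.pow_sub_le_descFactorial _ 5
    _ ≤ Nat.factorial 5 * (C * A.card.choose 5) := by
        rw [← Finset.mul_sum]
        exact Nat.mul_le_mul_left _ (hU.sum_choose_le A B)
    _ = C * A.card.descFactorial 5 := by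
        rw [Nat.descFactorial_eq_factorial_mul_choose]; ring
    _ ≤ C * A.card ^ 5 := Nat.mul_le_mul_left _ (Nat.descFactorial_le_pow _ 5)

theorem ncard_square_sums (A B : Finset ℤ) :
    {p : ℤ × ℤ | p.1 ∈ A ∧ p.2 ∈ B ∧ ∃ m : ℤ, p.1 + p.2 = m ^ 2}.ncard =
      ∑ b ∈ B, (squareNeighbors A b).card := by
  classical
  rw [← Finset.card_sigma, ← Set.ncard_coe_finset]
  refine Set.ncard_congr (fun p _ => ⟨p.2, p.1⟩) ?_ ?_ ?_
  · rintro ⟨a, b⟩ ⟨ha, hb, hm⟩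
    simp only [Finset.mem_coe, Finset.mem_sigma]
    exact ⟨hb, Finset.mem_filter.2 ⟨ha, hm⟩⟩
  · rintro ⟨a, b⟩ ⟨a', b'⟩ _ _ h
    simp_all
  · rintro ⟨b, a⟩ h
    simp only [Finset.mem_coe, Finset.mem_sigma] at h
    obtain ⟨ha, hm⟩ := Finset.mem_filter.1 h.2
    exact ⟨(a, b), ⟨ha, h.1, hm⟩, rfl⟩

/-- conditionally, the number of pairs `(a, b) ∈ A × B` with `a + b` a perfect
square is `O(|A|·|B|^{4/5} + |B|)`. -/
theorem square_sums_pairs (C : ℕ) (hC : 1 ≤ C) (hU : U5 C) :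
    ∃ K : ℝ, 1 ≤ K ∧
      ∀ (A B : Finset ℤ), 5 ≤ A.card → A.card ≤ B.card →
        (({p : ℤ × ℤ | p.1 ∈ A ∧ p.2 ∈ B ∧ ∃ m : ℤ, p.1 + p.2 = m ^ 2}.ncard : ℝ)) ≤
          K * ((A.card : ℝ) * (B.card : ℝ) ^ ((4 : ℝ) / 5) + (B.card : ℝ)) := by
  have hC' : (1 : ℝ) ≤ C := by exact_mod_cast hC
  refine ⟨C + 4, by linarith, fun A B _ _ => ?_⟩
  rw [ncard_square_sums]
  set r : ℝ := (B.card : ℝ) ^ ((4 : ℝ) / 5) with hr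
  have hr0 : 0 ≤ r := by positivity
  have hr5 : r ^ 5 = (B.card : ℝ) ^ 4 := by
    rw [hr, ← Real.rpow_natCast, ← Real.rpow_mul (by positivity), ← Real.rpow_natCast]
    norm_num
  have hsplit : ∑ b ∈ B, (squareNeighbors A b).card ≤
      ∑ b ∈ B, ((squareNeighbors A b).card - 4) + B.card * 4 := by
    rw [← smul_eq_mul, ← Finset.sum_const, ← Finset.sum_add_distrib]
    exact Finset.sum_le_sum fun b _ => by omega
  have hmain : ((∑ b ∈ B, ((squareNeighbors A b).card - 4) : ℕ) : ℝ) ≤ C * (A.card * r) := by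
    refine le_of_pow_le_pow_left₀ (n := 5) (by norm_num) (by positivity) ?_
    have hpow : (∑ b ∈ B, (((squareNeighbors A b).card - 4 : ℕ) : ℝ) ^ 5) ≤
        C * (A.card : ℝ) ^ 5 := by
      exact_mod_cast hU.sum_sub_pow_le A B
    have hCC : (C : ℝ) ≤ (C : ℝ) ^ 5 := le_self_pow₀ hC' (by norm_num)
    push_cast
    calc _ ≤ (B.card : ℝ) ^ 4 * ∑ b ∈ B, (((squareNeighbors A b).card - 4 : ℕ) : ℝ) ^ 5 :=
          pow_sum_le_card_mul_sum_pow (fun _ _ => Nat.cast_nonneg _) 4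
      _ ≤ (B.card : ℝ) ^ 4 * ((C : ℝ) ^ 5 * (A.card : ℝ) ^ 5) := by
          gcongr
          exact hpow.trans (by gcongr)
      _ = (C * (A.card * r)) ^ 5 := by rw [← hr5]; ring
  have hsplit' : ((∑ b ∈ B, (squareNeighbors A b).card : ℕ) : ℝ) ≤
      ((∑ b ∈ B, ((squareNeighbors A b).card - 4) : ℕ) : ℝ) + B.card * 4 := by
    exact_mod_cast hsplit
  have h1 : 0 ≤ (A.card : ℝ) * r := by positivity
  have h2 : 0 ≤ (C : ℝ) * B.card := by positivity
  linarith
end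

section
/- Assume Hypothesis (U5) with constant C. If a₁, …, a_k are pairwise distinct integers such that a_i + a_j is a perfect square for all i ≠ j, then k ≤ C + 5. -/
open Finset

/-- if `a₁, …, a_k` are pairwise distinct integers such that `a_i + a_j` is a
perfect square for all `i ≠ j`, then `k ≤ C + 5`. -/
theorem erdos_square_sums (C : ℕ) (hC : 1 ≤ C) (hU : U5 C)
    (k : ℕ) (a : Fin k → ℤ) (hinj : Function.Injective a)
    (hsq : ∀ i j, i ≠ j → ∃ m : ℤ, a i + a j = m ^ 2) :
    k ≤ C + 5 := by
  rcases le_total k 5 with hk | hk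
  · omega
  obtain ⟨n, rfl⟩ := Nat.exists_eq_add_of_le hk
  have hne : ∀ (i : Fin 5) (j : Fin n), Fin.natAdd 5 j ≠ Fin.castAdd n i := by
    intro i j h
    have := congrArg Fin.val h
    simp only [Fin.val_natAdd, Fin.val_castAdd] at this
    omega
  choose m hm using fun i j => hsq _ _ (hne i j)
  obtain ⟨hfin, hcard⟩ := hU (fun i => a (Fin.castAdd n i))
    (hinj.comp (Fin.castAdd_injective 5 n))
  let f : Fin n → ℚ × ℚ := fun j => ((a (Fin.natAdd 5 j) : ℚ), ∏ i, (m i j : ℚ))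
  have hf : Function.Injective f := fun x y h => by
    have h1 : (a (Fin.natAdd 5 x) : ℚ) = a (Fin.natAdd 5 y) := congrArg Prod.fst h
    exact Fin.natAdd_injective n 5 (hinj (by exact_mod_cast h1))
  have hsub : Set.range f ⊆
      {p : ℚ × ℚ | p.2 ^ 2 = ∏ i, (p.1 + ((a (Fin.castAdd n i) : ℤ) : ℚ))} := by
    rintro _ ⟨j, rfl⟩
    simp only [Set.mem_ofPred_eq, f, ← Finset.prod_pow]
    exact Finset.prod_congr rfl fun i _ => by exact_mod_cast (hm i j).symm
  have hle := (Set.ncard_le_ncard hsub hfin).trans hcard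
  rw [← Set.image_univ, Set.ncard_image_of_injective _ hf, Set.ncard_univ, Nat.card_fin] at hle
  omega
end
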